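/- Suppose the uniform conditional mixing assumption holds: lim_{M→∞} limsup_{T→∞} E[(1/T) Σ_{k=1}^{T} ess sup_{u,u' ∈ 𝕌_0} |E[(ℓ̄_0^M(u) ∘ T^{−k}) · ℓ̄_0^M(u') | 𝒴_{−∞,0}]|] = 0. Then every mean-optimal strategy ũ is weakly pathwise optimal, and L_T(ũ) → L* := E[ess inf_{u ∈ 𝕌_0} E[ℓ_0(u) | 𝒴_{−∞,0}]] in L¹(P) as T → ∞. -/

import Mathlib

open MeasureTheory Filter Set
open scoped ENNReal Topology symmDiff

noncomputable section

namespace ErgodicDecisions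

variable {Ω U : Type*}

/-- The `ℤ`-indexed iterates of an invertible transformation `T` with inverse `S`:
`iter T S n = Tⁿ` for `n ≥ 0` and `iter T S (-n) = Sⁿ`. -/
def iter (T S : Ω → Ω) : ℤ → Ω → Ω
  | Int.ofNat n => T^[n]
  | Int.negSucc n => S^[n + 1]

variable {m0 : MeasurableSpace Ω} [mU : MeasurableSpace U]

/-- The observation σ-field `𝒴_{m,n} = ⋁_{k=m}^{n} T^{-k} 𝒴`. -/
def obsField (T S : Ω → Ω) (Y : MeasurableSpace Ω) (m n : ℤ) : MeasurableSpace Ω :=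
  ⨆ k ∈ Set.Icc m n, MeasurableSpace.comap (iter T S k) Y

/-- The observation σ-field `𝒴_{-∞,n} = ⋁_{k ≤ n} T^{-k} 𝒴`. -/
def obsFieldLE (T S : Ω → Ω) (Y : MeasurableSpace Ω) (n : ℤ) : MeasurableSpace Ω :=
  ⨆ k ∈ Set.Iic n, MeasurableSpace.comap (iter T S k) Y

/-- `𝕌_{m,n}`: the set of `𝒴_{m,n}`-measurable decision maps `Ω → U`. -/
def Umn (T S : Ω → Ω) (Y : MeasurableSpace Ω) (m n : ℤ) : Set (Ω → U) :=
  {v | Measurable[obsField T S Y m n] v}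

/-- `𝕌_n = ⋃_{m ≤ n} 𝕌_{m,n}`. -/
def Un (T S : Ω → Ω) (Y : MeasurableSpace Ω) (n : ℤ) : Set (Ω → U) :=
  ⋃ m ∈ Set.Iic n, Umn T S Y m n

/-- The loss at time `n` of the decision map `v`: `ℓ_n(v)(ω) = ℓ(v(ω), Tⁿω)`. -/
def lossAt (T S : Ω → Ω) (ℓ : U → Ω → ℝ) (n : ℤ) (v : Ω → U) (ω : Ω) : ℝ :=
  ℓ (v ω) (iter T S n ω)

/-- An admissible strategy: `u_k` is `𝒴_{0,k}`-measurable for every `k ≥ 1`. -/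
def Admissible (T S : Ω → Ω) (Y : MeasurableSpace Ω) (u : ℕ → Ω → U) : Prop :=
  ∀ k : ℕ, 1 ≤ k → u k ∈ Umn T S Y 0 (k : ℤ)

/-- The time-average loss `L_T(u) = T⁻¹ ∑_{k=1}^T ℓ_k(u_k)`. -/
def avgLoss (T S : Ω → Ω) (ℓ : U → Ω → ℝ) (u : ℕ → Ω → U) (n : ℕ) (ω : Ω) : ℝ :=
  (n : ℝ)⁻¹ * ∑ k ∈ Finset.Icc 1 n, lossAt T S ℓ (k : ℤ) (u k) ω

/-- `g` is an essential infimum (an a.e.-greatest lower bound among random variables)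
of the family `(f i)_{i ∈ S₀}` under `P`. -/
def IsEssInfFam {ι : Type*} (P : Measure Ω) (S₀ : Set ι) (f : ι → Ω → ℝ) (g : Ω → ℝ) : Prop :=
  Measurable[m0] g ∧ (∀ i ∈ S₀, ∀ᵐ ω ∂P, g ω ≤ f i ω) ∧
    ∀ h : Ω → ℝ, Measurable[m0] h → (∀ i ∈ S₀, ∀ᵐ ω ∂P, h ω ≤ f i ω) → ∀ᵐ ω ∂P, h ω ≤ g ω

/-- `g` is an essential supremum (an a.e.-least upper bound among random variables)
of the family `(f i)_{i ∈ S₀}` under `P`. -/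
def IsEssSupFam {ι : Type*} (P : Measure Ω) (S₀ : Set ι) (f : ι → Ω → ℝ) (g : Ω → ℝ) : Prop :=
  Measurable[m0] g ∧ (∀ i ∈ S₀, ∀ᵐ ω ∂P, f i ω ≤ g ω) ∧
    ∀ h : Ω → ℝ, Measurable[m0] h → (∀ i ∈ S₀, ∀ᵐ ω ∂P, f i ω ≤ h ω) → ∀ᵐ ω ∂P, g ω ≤ h ω

/-- A mean-optimal strategy in the sense of Lemma 2.5 of the paper:
`E[ℓ_k(ũ_k)|𝒴_{0,k}] ≤ ess inf_{u ∈ 𝕌_{0,k}} E[ℓ_k(u)|𝒴_{0,k}] + 1/k` a.s. for all `k ≥ 1`. -/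
def MeanOptimalStrategy (P : Measure Ω) (T S : Ω → Ω) (Y : MeasurableSpace Ω)
    (ℓ : U → Ω → ℝ) (ut : ℕ → Ω → U) : Prop :=
  Admissible T S Y ut ∧
    ∀ k : ℕ, 1 ≤ k → ∃ g : Ω → ℝ,
      IsEssInfFam P (Umn T S Y 0 (k : ℤ))
        (fun v => P[lossAt T S ℓ (k : ℤ) v | obsField T S Y 0 (k : ℤ)]) g ∧
      ∀ᵐ ω ∂P, (P[lossAt T S ℓ (k : ℤ) (ut k) | obsField T S Y 0 (k : ℤ)]) ω ≤ g ω + (k : ℝ)⁻¹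

/-- Pathwise optimality (Definition 2.2). -/
def PathwiseOptimal (P : Measure Ω) (T S : Ω → Ω) (Y : MeasurableSpace Ω)
    (ℓ : U → Ω → ℝ) (us : ℕ → Ω → U) : Prop :=
  Admissible T S Y us ∧
    ∀ u : ℕ → Ω → U, Admissible T S Y u →
      ∀ᵐ ω ∂P,
        0 ≤ Filter.liminf (fun n : ℕ => avgLoss T S ℓ u n ω - avgLoss T S ℓ us n ω) atTop

/-- Weak pathwise optimality (Definition 2.3). -/
def WeaklyPathwiseOptimal (P : Measure Ω) (T S : Ω → Ω) (Y : MeasurableSpace Ω)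
    (ℓ : U → Ω → ℝ) (us : ℕ → Ω → U) : Prop :=
  Admissible T S Y us ∧
    ∀ u : ℕ → Ω → U, Admissible T S Y u → ∀ ε : ℝ, 0 < ε →
      Tendsto (fun n : ℕ => P {ω | -ε ≤ avgLoss T S ℓ u n ω - avgLoss T S ℓ us n ω})
        atTop (𝓝 1)

/-- Mean optimality (Definition 2.4). -/
def MeanOptimal (P : Measure Ω) (T S : Ω → Ω) (Y : MeasurableSpace Ω)
    (ℓ : U → Ω → ℝ) (us : ℕ → Ω → U) : Prop :=
  Admissible T S Y us ∧
    ∀ u : ℕ → Ω → U, Admissible T S Y u →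
      0 ≤ Filter.liminf
        (fun n : ℕ => (∫ ω, avgLoss T S ℓ u n ω ∂P) - ∫ ω, avgLoss T S ℓ us n ω ∂P) atTop

/-- Two σ-fields on `Ω` agree modulo `P`-null sets. -/
def EqModP (P : Measure Ω) (m₁ m₂ : MeasurableSpace Ω) : Prop :=
  (∀ A : Set Ω, MeasurableSet[m₁] A → ∃ B : Set Ω, MeasurableSet[m₂] B ∧ P (A ∆ B) = 0) ∧
    ∀ A : Set Ω, MeasurableSet[m₂] A → ∃ B : Set Ω, MeasurableSet[m₁] B ∧ P (A ∆ B) = 0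

/-- Conditional K-automorphism relative to `Z` (Definition 1.4); `S` is the inverse of `T`,
so that `T^{-k}𝒳 = comap T^k 𝒳` and `T^{k}𝒳 = comap S^k 𝒳`. -/
def CondK (P : Measure Ω) (T S : Ω → Ω) (Z : MeasurableSpace Ω) : Prop :=
  ∃ X : MeasurableSpace Ω, X ≤ m0 ∧
    X ≤ MeasurableSpace.comap T X ∧
    EqModP P (⨆ k : ℕ, MeasurableSpace.comap (T^[k + 1]) X) m0 ∧
    EqModP P (⨅ k : ℕ, Z ⊔ MeasurableSpace.comap (S^[k + 1]) X) Z

/-- Conditional weak mixing relative to `Z` (Definition 1.3); `S` is the inverse of `T`,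
so that `T^k B = (S^[k])⁻¹ B`. -/
def CondWeakMixing (P : Measure Ω) (S : Ω → Ω) (Z : MeasurableSpace Ω) : Prop :=
  ∀ A B : Set Ω, MeasurableSet[m0] A → MeasurableSet[m0] B →
    Tendsto
      (fun n : ℕ => ∫ ω,
        (n : ℝ)⁻¹ * ∑ k ∈ Finset.Icc 1 n,
          |(P[(A ∩ S^[k] ⁻¹' B).indicator (fun _ => (1 : ℝ)) | Z]) ω -
            (P[A.indicator (fun _ => (1 : ℝ)) | Z]) ω *
              (P[(S^[k] ⁻¹' B).indicator (fun _ => (1 : ℝ)) | Z]) ω| ∂P)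
      atTop (𝓝 0)

/-- The tail σ-field `⋂_{k≥1} (𝒴_{-∞,0} ∨ T^k 𝒳)`. -/
def tailField (T S : Ω → Ω) (Y X : MeasurableSpace Ω) : MeasurableSpace Ω :=
  ⨅ k : ℕ, obsFieldLE T S Y 0 ⊔ MeasurableSpace.comap (S^[k + 1]) X

/-- The truncated loss `ℓ_0(v)·1_{Λ ≤ M}`. -/
def truncLoss (ℓ : U → Ω → ℝ) (Λ : Ω → ℝ) (M : ℝ) (v : Ω → U) (ω : Ω) : ℝ :=
  if Λ ω ≤ M then ℓ (v ω) ω else 0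

/-- `ℓ̄_0^M(v) = ℓ_0(v)·1_{Λ≤M} − E[ℓ_0(v)·1_{Λ≤M} | 𝒴_{-∞,0}]`. -/
def barLoss (P : Measure Ω) (T S : Ω → Ω) (Y : MeasurableSpace Ω)
    (ℓ : U → Ω → ℝ) (Λ : Ω → ℝ) (M : ℝ) (v : Ω → U) (ω : Ω) : ℝ :=
  truncLoss ℓ Λ M v ω - (P[truncLoss ℓ Λ M v | obsFieldLE T S Y 0]) ω

/-- The uniform conditional mixing assumption of Theorem 2.12:
`lim_{M→∞} limsup_{T→∞} E[(1/T)∑_{k=1}^T ess sup_{u,u'∈𝕌₀}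
|E[(ℓ̄₀^M(u)∘T^{-k})·ℓ̄₀^M(u')|𝒴_{-∞,0}]|] = 0`. -/
def UniformCondMixing (P : Measure Ω) (T S : Ω → Ω) (Y : MeasurableSpace Ω)
    (ℓ : U → Ω → ℝ) (Λ : Ω → ℝ) : Prop :=
  ∃ G : ℝ → ℕ → Ω → ℝ,
    (∀ (M : ℝ) (k : ℕ),
      IsEssSupFam P ((Un T S Y 0) ×ˢ (Un T S Y 0))
        (fun p ω =>
          |(P[(fun ω' => barLoss P T S Y ℓ Λ M p.1 (S^[k] ω') *
                barLoss P T S Y ℓ Λ M p.2 ω') | obsFieldLE T S Y 0]) ω|)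
        (G M k)) ∧
    Tendsto
      (fun M : ℝ =>
        Filter.limsup
          (fun n : ℕ => ∫ ω, (n : ℝ)⁻¹ * ∑ k ∈ Finset.Icc 1 n, G M k ω ∂P) atTop)
      atTop (𝓝 0)

/-- Equimeasurability of the loss (Definition 3.1): for every `ε > 0` there is a set of
probability at least `1-ε` on which the family `{ℓ(u,·) : u ∈ U}` is totally bounded
in `L^∞(P)`. -/
def Equimeasurable (P : Measure Ω) (ℓ : U → Ω → ℝ) : Prop :=
  ∀ ε : ℝ, 0 < ε → ∃ Ωε : Set Ω, MeasurableSet[m0] Ωε ∧ 1 - ENNReal.ofReal ε ≤ P Ωε ∧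
    ∀ δ : ℝ, 0 < δ → ∃ 𝒩 : Finset (Ω → ℝ), ∀ u : U, ∃ f ∈ 𝒩,
      eLpNorm (fun ω => Ωε.indicator (ℓ u) ω - f ω) ⊤ P ≤ ENNReal.ofReal δ



lemma l1_tri {Ω : Type*} [MeasurableSpace Ω] {P : Measure Ω} {f g h : Ω → ℝ}
   (hf : Integrable f P) (hg : Integrable g P) (hle : ∀ᵐ ω ∂P, |h ω| ≤ |f ω| + |g ω|) :
   ∫ ω, |h ω| ∂P ≤ (∫ ω, |f ω| ∂P) + ∫ ω, |g ω| ∂P := by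
  rw [← integral_add hf.abs hg.abs]
  exact integral_mono_of_nonneg (ae_of_all _ fun _ => abs_nonneg _) (hf.abs.add hg.abs) hle

lemma abs_avg_le {Ω : Type*} [m0 : MeasurableSpace Ω] {P : Measure Ω} 
    (f : ℕ → Ω → ℝ) (hf : ∀ k, Integrable (f k) P) (s : Finset ℕ) (a C : ℝ) (ha : 0 ≤ a)
    (hC : ∀ k, ∫ ω, |f k ω| ∂P ≤ C) : 
    ∫ ω, |a * ∑ k ∈ s, f k ω| ∂P ≤ a * (s.card * C) := by
  calc ∫ ω, |a * ∑ k ∈ s, f k ω| ∂P ≤ ∫ ω, a * ∑ k ∈ s, |f k ω| ∂P := by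
        refine integral_mono_of_nonneg (ae_of_all _ fun _ => abs_nonneg _) 
          ((integrable_finsetSum _ fun k _ => (hf k).abs).const_mul a) (ae_of_all _ fun ω => ?_)
        simp only [abs_mul, abs_of_nonneg ha]
        exact mul_le_mul_of_nonneg_left (Finset.abs_sum_le_sum_abs _ _) ha
    _ = a * ∑ k ∈ s, ∫ ω, |f k ω| ∂P := by
        rw [integral_const_mul, integral_finsetSum _ fun k _ => (hf k).abs]
    _ ≤ a * (s.card * C) := by
        gcongr
        simpa using Finset.sum_le_card_nsmul s _ C (fun k _ => hC k)

lemma mean_ergodic_L2 {Ω : Type*} [m0 : MeasurableSpace Ω] {P : Measure Ω} [IsProbabilityMeasure P]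
    {T : Ω → Ω} (hT : Ergodic T P) {f : Ω → ℝ} (hf : MemLp f 2 P) :
    Tendsto (fun n : ℕ => ∫ ω, |(n : ℝ)⁻¹ * ∑ k ∈ Finset.range n, f (T^[k] ω) - ∫ ω', f ω' ∂P| ∂P)
      atTop (𝓝 0) := by
  have hTm := hT.toMeasurePreserving
  obtain ⟨K, hK, hKapp⟩ : ∃ K : Lp ℝ 2 P →L[ℝ] Lp ℝ 2 P, ‖K‖ ≤ 1 ∧
      ∀ x, K x = Lp.compMeasurePreserving T hTm x := by
    have I : ∃ I : Lp ℝ 2 P →ₗᵢ[ℝ] Lp ℝ 2 P, ∀ x, I x = Lp.compMeasurePreserving T hTm x :=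
      ⟨Lp.compMeasurePreservingₗᵢ ℝ T hTm, fun x => rfl⟩
    obtain ⟨I, hI⟩ := I
    exact ⟨I.toContinuousLinearMap, I.norm_toContinuousLinearMap_le, hI⟩
  have hconv := K.tendsto_birkhoffAverage_orthogonalProjection hK (hf.toLp f)
  set y : Lp ℝ 2 P := ((K.eqLocus (1 : Lp ℝ 2 P →L[ℝ] Lp ℝ 2 P)).orthogonalProjectionOnto (hf.toLp f) : Lp ℝ 2 P) with hy
  have hKy : K y = y := by
    have := ((K.eqLocus (1 : Lp ℝ 2 P →L[ℝ] Lp ℝ 2 P)).orthogonalProjectionOnto (hf.toLp f)).2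
    exact this
  obtain ⟨c, hc⟩ : ∃ c, (y : Ω → ℝ) =ᵐ[P] Function.const Ω c := by
    refine hT.ae_eq_const_of_ae_eq_comp_ae (Lp.aestronglyMeasurable y) ?_
    have h1 := Lp.coeFn_compMeasurePreserving y hTm
    have h2 : Lp.compMeasurePreserving T hTm y = y := (hKapp y).symm.trans hKy
    rw [h2] at h1
    exact h1.symm
  have hiter : ∀ k : ℕ, (K^[k] (hf.toLp f) : Ω → ℝ) =ᵐ[P] fun ω => f (T^[k] ω) := by
    intro k
    have h1 : K^[k] (hf.toLp f) = Lp.compMeasurePreserving T^[k] (hTm.iterate k) (hf.toLp f) := by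
      rw [← Lp.compMeasurePreserving_iterate]
      have : (K : Lp ℝ 2 P → Lp ℝ 2 P) = Lp.compMeasurePreserving T hTm := funext hKapp
      rw [this]
    rw [h1]
    refine (Lp.coeFn_compMeasurePreserving _ _).trans ?_
    exact (hTm.iterate k).quasiMeasurePreserving.ae_eq_comp hf.coeFn_toLp
  have havg : ∀ n : ℕ, ((birkhoffAverage ℝ K _root_.id n (hf.toLp f) : Lp ℝ 2 P) : Ω → ℝ) =ᵐ[P]
      fun ω => (n : ℝ)⁻¹ * ∑ k ∈ Finset.range n, f (T^[k] ω) := by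
    intro n
    unfold birkhoffAverage birkhoffSum
    refine (Lp.coeFn_smul _ _).trans ?_
    have h2 := Lp.coeFn_finsetSum (Finset.range n) (fun k => _root_.id (K^[k] (hf.toLp f)))
    filter_upwards [h2, ae_all_iff.2 hiter] with ω h2 h3
    simp only [Pi.smul_apply, smul_eq_mul]
    rw [h2, Finset.sum_apply]
    simp only [_root_.id, h3]
  have hint : ∀ k : ℕ, Integrable (fun ω => f (T^[k] ω)) P := fun k =>
    (hTm.iterate k).integrable_comp_of_integrable (hf.integrable (by norm_num))
  have hfi : ∀ k : ℕ, ∫ ω, f (T^[k] ω) ∂P = ∫ ω, f ω ∂P := fun k => by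
    have h := (hTm.iterate k)
    have := integral_map (μ := P) (φ := T^[k]) h.measurable.aemeasurable (f := f) (by rw [h.map_eq]; exact hf.1)
    rw [h.map_eq] at this; exact this.symm
  have hlim : Tendsto (fun n : ℕ => ∫ ω, |(n : ℝ)⁻¹ * ∑ k ∈ Finset.range n, f (T^[k] ω) - c| ∂P)
      atTop (𝓝 0) := by
    have h0 : Tendsto (fun n => ‖birkhoffAverage ℝ K _root_.id n (hf.toLp f) - y‖) atTop (𝓝 0) :=
      tendsto_iff_norm_sub_tendsto_zero.1 hconv
    refine squeeze_zero (fun n => integral_nonneg fun _ => abs_nonneg _) (fun n => ?_) h0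
    rw [Lp.norm_def]
    set z := birkhoffAverage ℝ K _root_.id n (hf.toLp f) - y with hz
    have hzae : (z : Ω → ℝ) =ᵐ[P] fun ω => (n : ℝ)⁻¹ * ∑ k ∈ Finset.range n, f (T^[k] ω) - c := by
      filter_upwards [Lp.coeFn_sub (birkhoffAverage ℝ K _root_.id n (hf.toLp f)) y, havg n, hc] with ω h1 h2 h3
      rw [hz, h1, Pi.sub_apply, h2, h3]; rfl
    have h1 : ∫ ω, |(n : ℝ)⁻¹ * ∑ k ∈ Finset.range n, f (T^[k] ω) - c| ∂P = (eLpNorm z 1 P).toReal := by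
      rw [eLpNorm_one_eq_lintegral_enorm, ← integral_norm_eq_lintegral_enorm (Lp.aestronglyMeasurable z)]
      refine integral_congr_ae ?_
      filter_upwards [hzae] with ω h
      rw [h, Real.norm_eq_abs]
    rw [h1]
    exact ENNReal.toReal_mono (Lp.eLpNorm_ne_top z) (eLpNorm_le_eLpNorm_of_exponent_le (by norm_num) (Lp.aestronglyMeasurable z))
  have hcf : c = ∫ ω, f ω ∂P := by
    have hle : ∀ᶠ n : ℕ in atTop, |(∫ ω, f ω ∂P) - c| ≤ ∫ ω, |(n : ℝ)⁻¹ * ∑ k ∈ Finset.range n, f (T^[k] ω) - c| ∂P := by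
      filter_upwards [eventually_gt_atTop 0] with n hn
      have hI : Integrable (fun ω => (n : ℝ)⁻¹ * ∑ k ∈ Finset.range n, f (T^[k] ω)) P :=
        (integrable_finsetSum _ fun k _ => hint k).const_mul _
      have : (∫ ω, f ω ∂P) - c = ∫ ω, ((n : ℝ)⁻¹ * ∑ k ∈ Finset.range n, f (T^[k] ω) - c) ∂P := by
        rw [integral_sub hI (integrable_const c), integral_const_mul, integral_finsetSum _ fun k _ => hint k]
        simp only [hfi]
        have : (n:ℝ) ≠ 0 := by positivity
        simp [this]
      rw [this]; exact abs_integral_le_integral_abs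
    have := le_of_tendsto_of_tendsto tendsto_const_nhds hlim hle
    have := abs_nonpos_iff.1 this
    linarith
  rw [← hcf]; exact hlim

lemma mean_ergodic_L1 {Ω : Type*} [m0 : MeasurableSpace Ω] {P : Measure Ω} [IsProbabilityMeasure P]
    {T : Ω → Ω} (hT : Ergodic T P) {f : Ω → ℝ} (hf : Integrable f P) :
    Tendsto (fun n : ℕ => ∫ ω, |(n : ℝ)⁻¹ * ∑ k ∈ Finset.Icc 1 n, f (T^[k] ω) - ∫ ω', f ω' ∂P| ∂P)
      atTop (𝓝 0) := by
  have hTm := hT.toMeasurePreserving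
  have hcomp : ∀ g : Ω → ℝ, Integrable g P → ∀ k : ℕ, Integrable (fun ω => g (T^[k] ω)) P := fun g hg k =>
    (hTm.iterate k).integrable_comp_of_integrable hg
  have hfi : ∀ g : Ω → ℝ, Integrable g P → ∀ k : ℕ, ∫ ω, g (T^[k] ω) ∂P = ∫ ω, g ω ∂P := fun g hg k => by
    have h := (hTm.iterate k)
    have := integral_map (μ := P) (φ := T^[k]) h.measurable.aemeasurable (f := g) (by rw [h.map_eq]; exact hg.1)
    rw [h.map_eq] at this; exact this.symm
  have hR : Tendsto (fun n : ℕ => ∫ ω, |(n : ℝ)⁻¹ * ∑ k ∈ Finset.range n, f (T^[k] ω) - ∫ ω', f ω' ∂P| ∂P)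
      atTop (𝓝 0) := by
    rw [Metric.tendsto_atTop]
    intro ε hε
    obtain ⟨g, hg, -⟩ := (memLp_one_iff_integrable.2 hf).exists_simpleFunc_eLpNorm_sub_lt (by norm_num)
      (ε := ENNReal.ofReal (ε / 4)) (by simpa using hε)
    have hgi : Integrable g P := g.integrable_of_isFiniteMeasure
    have hd : ∫ ω, |f ω - g ω| ∂P ≤ ε / 4 := by
      rw [eLpNorm_one_eq_lintegral_enorm] at hg
      have h := integral_norm_eq_lintegral_enorm (hf.sub hgi).1
      simp only [Pi.sub_apply, Real.norm_eq_abs] at h hg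
      rw [h]
      exact ENNReal.toReal_le_of_le_ofReal (by positivity) hg.le
    have h2 := mean_ergodic_L2 hT (f := g) (g.memLp_of_isFiniteMeasure 2 P)
    obtain ⟨N, hN⟩ := Metric.tendsto_atTop.1 h2 (ε / 4) (by positivity)
    refine ⟨N + 1, fun n hn => ?_⟩
    have hNn := hN n (by omega)
    have hn0 : (n : ℝ) ≠ 0 := by have : 0 < n := by omega
                                 positivity
    rw [Real.dist_eq, sub_zero, abs_of_nonneg (integral_nonneg fun _ => abs_nonneg _)] at hNn ⊢
    have hdi := hf.sub hgi
    have e1 := abs_avg_le (P := P) (fun k ω => f (T^[k] ω) - g (T^[k] ω)) (fun k => hcomp _ hdi k) (Finset.range n) (n : ℝ)⁻¹ (ε / 4)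
      (by positivity) (fun k => by rw [hfi (fun ω => |f ω - g ω|) hdi.abs k]; exact hd)
    have e2 : |(∫ ω, g ω ∂P) - ∫ ω, f ω ∂P| ≤ ε / 4 := by
      rw [← integral_sub hgi hf]
      refine abs_integral_le_integral_abs.trans (le_trans (le_of_eq ?_) hd)
      simp only [abs_sub_comm]
    have t1 := l1_tri (P := P) (f := fun ω => (n : ℝ)⁻¹ * ∑ k ∈ Finset.range n, (f (T^[k] ω) - g (T^[k] ω)))
      (g := fun ω => ((n : ℝ)⁻¹ * ∑ k ∈ Finset.range n, g (T^[k] ω) - ∫ ω', g ω' ∂P)) 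
      (h := fun ω => (n : ℝ)⁻¹ * ∑ k ∈ Finset.range n, f (T^[k] ω) - ∫ ω', g ω' ∂P)
      ((integrable_finsetSum _ fun k _ => hcomp _ hdi k).const_mul _)
      (((integrable_finsetSum _ fun k _ => hcomp _ hgi k).const_mul _).sub (integrable_const _))
      (ae_of_all _ fun ω => by
        refine le_trans (le_of_eq ?_) (abs_add_le _ _)
        rw [Finset.sum_sub_distrib]; ring_nf)
    have t2 := l1_tri (P := P) (f := fun ω => (n : ℝ)⁻¹ * ∑ k ∈ Finset.range n, f (T^[k] ω) - ∫ ω', g ω' ∂P)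
      (g := fun ω => (∫ ω, g ω ∂P) - ∫ ω, f ω ∂P) 
      (h := fun ω => (n : ℝ)⁻¹ * ∑ k ∈ Finset.range n, f (T^[k] ω) - ∫ ω', f ω' ∂P)
      (((integrable_finsetSum _ fun k _ => hcomp _ hf k).const_mul _).sub (integrable_const _))
      (integrable_const _)
      (ae_of_all _ fun ω => by
        refine le_trans (le_of_eq ?_) (abs_add_le _ _)
        ring_nf)
    simp only [integral_const, probReal_univ, one_smul] at t2
    rw [Finset.card_range, inv_mul_cancel_left₀ hn0] at e1
    linarith
  refine hR.congr fun n => ?_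
  have hh : Integrable (fun ω => |(n : ℝ)⁻¹ * ∑ k ∈ Finset.range n, f (T^[k] ω) - ∫ ω', f ω' ∂P|) P :=
    (((integrable_finsetSum _ fun k _ => hcomp _ hf k).const_mul _).sub (integrable_const _)).abs
  rw [← hfi _ hh 1]
  congr 1
  ext ω
  congr 3
  have h1 : Finset.Icc 1 n = Finset.Ico (0 + 1) (n + 1) := by ext; simp
  rw [h1, ← Finset.sum_Ico_add', Finset.range_eq_Ico]
  rfl

lemma iter_eq_perm (T S : Ω → Ω) (hST : Function.LeftInverse S T) (hTS : Function.RightInverse S T)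
    (n : ℤ) : iter T S n = ((⟨T, S, hST, hTS⟩ : Equiv.Perm Ω) ^ n : Equiv.Perm Ω) := by
  set e : Equiv.Perm Ω := ⟨T, S, hST, hTS⟩ with he
  cases n with
  | ofNat n =>
    change T^[n] = _
    rw [Int.ofNat_eq_natCast, zpow_natCast, Equiv.Perm.coe_pow]; rfl
  | negSucc n =>
    change S^[n + 1] = _
    rw [zpow_negSucc, ← inv_pow, Equiv.Perm.coe_pow]; rfl

lemma iter_comp (T S : Ω → Ω) (hST : Function.LeftInverse S T) (hTS : Function.RightInverse S T)
    (a b : ℤ) : iter T S a ∘ iter T S b = iter T S (a + b) := by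
  rw [iter_eq_perm T S hST hTS, iter_eq_perm T S hST hTS, iter_eq_perm T S hST hTS, zpow_add]; rfl

lemma iter_neg (T S : Ω → Ω) (k : ℕ) : iter T S (-(k : ℤ)) = S^[k] := by
  cases k with
  | zero => rfl
  | succ n => rfl

lemma iter_measurable {m0 : MeasurableSpace Ω} {T S : Ω → Ω} (hT : Measurable T) (hS : Measurable S)
    (n : ℤ) : Measurable (iter T S n) := by
  cases n with
  | ofNat n => exact hT.iterate n
  | negSucc n => exact hS.iterate (n + 1)

lemma obsField_le {m0 : MeasurableSpace Ω} {T S : Ω → Ω} (hT : Measurable T) (hS : Measurable S)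
    {Y : MeasurableSpace Ω} (hY : Y ≤ m0) (a b : ℤ) : obsField T S Y a b ≤ m0 := by
  refine iSup₂_le fun k _ => ?_
  exact measurable_iff_comap_le.1 ((iter_measurable hT hS k).mono le_rfl hY)

lemma obsFieldLE_le {m0 : MeasurableSpace Ω} {T S : Ω → Ω} (hT : Measurable T) (hS : Measurable S)
    {Y : MeasurableSpace Ω} (hY : Y ≤ m0) (b : ℤ) : obsFieldLE T S Y b ≤ m0 := by
  refine iSup₂_le fun k _ => ?_
  exact measurable_iff_comap_le.1 ((iter_measurable hT hS k).mono le_rfl hY)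

lemma obsField_mono {T S : Ω → Ω} {Y : MeasurableSpace Ω} {a a' b b' : ℤ} (ha : a' ≤ a) (hb : b ≤ b') :
    obsField T S Y a b ≤ obsField T S Y a' b' := 
  biSup_mono fun _ hk => ⟨ha.trans hk.1, hk.2.trans hb⟩

lemma obsFieldLE_eq (T S : Ω → Ω) (Y : MeasurableSpace Ω) :
    obsFieldLE T S Y 0 = ⨆ n : ℕ, obsField T S Y (-(n : ℤ)) 0 := by
  apply le_antisymm
  · refine iSup₂_le fun k hk => ?_
    have hk' : k ≤ 0 := hk
    refine le_iSup_of_le k.natAbs ?_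
    have hm : k ∈ Set.Icc (-(k.natAbs : ℤ)) 0 := ⟨by omega, hk'⟩
    exact le_biSup (fun k => MeasurableSpace.comap (iter T S k) Y) hm
  · refine iSup_le fun n => biSup_mono fun k hk => hk.2

lemma mem_Un_iff (T S : Ω → Ω) (Y : MeasurableSpace Ω) (v : Ω → U) :
    v ∈ (Un T S Y 0 : Set (Ω → U)) ↔ ∃ n : ℕ, Measurable[obsField T S Y (-(n : ℤ)) 0] v := by
  simp only [Un, Umn, Set.mem_iUnion, Set.mem_ofPred_eq, Set.mem_Iic]
  constructor
  · rintro ⟨m, hm, h⟩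
    exact ⟨m.natAbs, h.mono (obsField_mono (by omega) le_rfl) le_rfl⟩
  · rintro ⟨n, h⟩
    exact ⟨-(n : ℤ), by omega, h⟩

lemma shift_measurable (T S : Ω → Ω) (hST : Function.LeftInverse S T) (hTS : Function.RightInverse S T)
    (Y : MeasurableSpace Ω) (a b j : ℤ) (u : Ω → U) (hu : Measurable[obsField T S Y a b] u) :
    Measurable[obsField T S Y (a + j) (b + j)] (u ∘ iter T S j) := by
  suffices key : Measurable[obsField T S Y (a + j) (b + j), obsField T S Y a b] (iter T S j) from hu.comp key
  rw [measurable_iff_comap_le]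
  unfold obsField
  simp only [MeasurableSpace.comap_iSup, MeasurableSpace.comap_comp, iter_comp T S hST hTS]
  refine iSup₂_le fun k hk => ?_
  exact le_iSup₂_of_le (f := fun k (_ : k ∈ Set.Icc (a + j) (b + j)) => MeasurableSpace.comap (iter T S k) Y)
    (k + j) ⟨by have := hk.1; omega, by have := hk.2; omega⟩ le_rfl

lemma approx_set {m0 : MeasurableSpace Ω} (P : Measure Ω) [IsFiniteMeasure P] (F : ℕ → MeasurableSpace Ω)
    (hmono : Monotone F) (hle : ∀ n, F n ≤ m0) {A : Set Ω} (hA : MeasurableSet[⨆ n, F n] A) {ε : ℝ≥0∞} (hε : 0 < ε) :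
    ∃ n, ∃ A', MeasurableSet[F n] A' ∧ P (A' ∆ A) < ε := by
  set C : Set (Set Ω) := {s | ∃ n, MeasurableSet[F n] s} with hC
  have hsup : (⨆ n, F n) ≤ m0 := iSup_le hle
  have hring : IsSetRing C := by
    refine ⟨⟨0, @MeasurableSet.empty _ (F 0)⟩, ?_, ?_⟩
    · rintro s t ⟨n, hs⟩ ⟨m, ht⟩
      exact ⟨max n m, (hmono (le_max_left n m) _ hs).union (hmono (le_max_right n m) _ ht)⟩
    · rintro s t ⟨n, hs⟩ ⟨m, ht⟩
      exact ⟨max n m, (hmono (le_max_left n m) _ hs).diff (hmono (le_max_right n m) _ ht)⟩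
  have hgen : (⨆ n, F n) = MeasurableSpace.generateFrom C := by
    rw [← MeasurableSpace.generateFrom_iUnion_measurableSet]
    congr 1
    ext s; simp [hC]
  obtain ⟨t, ⟨n, ht⟩, htA⟩ := @exists_measure_symmDiff_lt_of_generateFrom_isSetRing Ω (⨆ n, F n) (P.trim hsup) _ C hring
    ⟨{Set.univ}, by simp, by simpa [hC] using ⟨0, MeasurableSet.univ⟩, by simp⟩ hgen A hA ε hε
  refine ⟨n, t, ht, ?_⟩
  rwa [trim_measurableSet_eq hsup] at htA
  exact MeasurableSet.symmDiff (le_iSup F n _ ht) hA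

lemma approx_integral {m0 : MeasurableSpace Ω} (P : Measure Ω) [IsFiniteMeasure P] (F : ℕ → MeasurableSpace Ω)
    (hmono : Monotone F) (hle : ∀ n, F n ≤ m0) {A : Set Ω} (hA : MeasurableSet[⨆ n, F n] A) {ε : ℝ} (hε : 0 < ε)
    {φ : Ω → ℝ} (hφ : Integrable φ P) :
    ∃ n, ∃ A', MeasurableSet[F n] A' ∧ ∫ ω in A', φ ω ∂P ≤ (∫ ω in A, φ ω ∂P) + ε := by
  have hfin : IsFiniteMeasure (P.withDensity fun ω => ‖φ ω‖ₑ) := isFiniteMeasure_withDensity hφ.2.ne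
  obtain ⟨n, A', hA', hlt⟩ := approx_set (P.withDensity fun ω => ‖φ ω‖ₑ) F hmono hle hA (ε := ENNReal.ofReal ε) (by simpa using hε)
  refine ⟨n, A', hA', ?_⟩
  have mA : MeasurableSet A := iSup_le hle _ hA
  have mA' : MeasurableSet A' := hle n _ hA'
  rw [withDensity_apply _ (mA'.symmDiff mA)] at hlt
  have h1 : ∫ ω in A' ∆ A, |φ ω| ∂P ≤ ε := by
    have := integral_norm_eq_lintegral_enorm (hφ.restrict (s := A' ∆ A)).1
    simp only [Real.norm_eq_abs] at this
    rw [this]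
    exact ENNReal.toReal_le_of_le_ofReal hε.le hlt.le
  have h2 : (∫ ω in A', φ ω ∂P) - (∫ ω in A, φ ω ∂P) ≤ ∫ ω in A' ∆ A, |φ ω| ∂P := by
    rw [← integral_indicator mA, ← integral_indicator mA', ← integral_indicator (mA'.symmDiff mA),
      ← integral_sub (hφ.indicator mA') (hφ.indicator mA)]
    refine integral_mono ((hφ.indicator mA').sub (hφ.indicator mA)) (hφ.abs.indicator (mA'.symmDiff mA)) fun ω => ?_
    have := le_abs_self (φ ω); have := neg_abs_le (φ ω)
    by_cases h : ω ∈ A <;> by_cases h' : ω ∈ A' <;> simp [h, h', Set.mem_symmDiff] <;> linarith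
  linarith

lemma isub {Ω : Type*} [MeasurableSpace Ω] {P : Measure Ω} {f g : Ω → ℝ} (hf : Integrable f P) (hg : Integrable g P) :
    Integrable (fun ω => f ω - g ω) P := hf.sub hg

lemma iadd {Ω : Type*} [MeasurableSpace Ω] {P : Measure Ω} {f g : Ω → ℝ} (hf : Integrable f P) (hg : Integrable g P) :
    Integrable (fun ω => f ω + g ω) P := hf.add hg

lemma imin {Ω : Type*} [MeasurableSpace Ω] {P : Measure Ω} {f g : Ω → ℝ} (hf : Integrable f P) (hg : Integrable g P) :
    Integrable (fun ω => min (f ω) (g ω)) P := hf.inf hg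

section Main

variable {Ω U : Type*} {Y : MeasurableSpace Ω} [m0 : MeasurableSpace Ω] [mU : MeasurableSpace U]
  {P : Measure Ω} [IsProbabilityMeasure P] {T S : Ω → Ω} {ℓ : U → Ω → ℝ} {Λ : Ω → ℝ}

lemma loss_integrable (hℓ : Measurable fun p : U × Ω => ℓ p.1 p.2) (hΛ : Integrable Λ P)
    (hdom : ∀ u ω, |ℓ u ω| ≤ Λ ω) {v : Ω → U} (hv : Measurable v) :
    Integrable (fun ω => ℓ (v ω) ω) P := by
  refine hΛ.mono' (hℓ.comp (hv.prodMk measurable_id)).aestronglyMeasurable (ae_of_all _ fun ω => ?_)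
  exact hdom _ _

lemma Un_measurable (hT : Measurable T) (hS : Measurable S) (hY : Y ≤ m0) {v : Ω → U}
    (hv : v ∈ (Un T S Y 0 : Set (Ω → U))) : Measurable v := by
  obtain ⟨n, hn⟩ := (mem_Un_iff T S Y v).1 hv
  exact hn.mono (obsField_le hT hS hY _ _) le_rfl

/-- gluing -/
lemma glue (hT : Measurable T) (hS : Measurable S)
    (hℓ : Measurable fun p : U × Ω => ℓ p.1 p.2) (hΛ : Integrable Λ P)
    (hdom : ∀ u ω, |ℓ u ω| ≤ Λ ω) (hY : Y ≤ m0) (c : ℝ)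
    (hc : ∀ v ∈ (Un T S Y 0 : Set (Ω → U)), c ≤ ∫ ω, ℓ (v ω) ω ∂P)
    {v w : Ω → U} (hv : v ∈ (Un T S Y 0 : Set (Ω → U))) (hw : w ∈ (Un T S Y 0 : Set (Ω → U))) :
    c ≤ ∫ ω, min ((P[fun ω => ℓ (v ω) ω | obsFieldLE T S Y 0]) ω)
      ((P[fun ω => ℓ (w ω) ω | obsFieldLE T S Y 0]) ω) ∂P := by
  have hLE : obsFieldLE T S Y 0 ≤ m0 := obsFieldLE_le hT hS hY 0
  set f := P[fun ω => ℓ (v ω) ω | obsFieldLE T S Y 0] with hf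
  set g := P[fun ω => ℓ (w ω) ω | obsFieldLE T S Y 0] with hg
  have iv := loss_integrable (P := P) hℓ hΛ hdom (Un_measurable hT hS hY hv)
  have iw := loss_integrable (P := P) hℓ hΛ hdom (Un_measurable hT hS hY hw)
  have hfm : StronglyMeasurable[obsFieldLE T S Y 0] f := stronglyMeasurable_condExp
  have hgm : StronglyMeasurable[obsFieldLE T S Y 0] g := stronglyMeasurable_condExp
  set A : Set Ω := {ω | f ω ≤ g ω} with hA
  have mA : MeasurableSet[obsFieldLE T S Y 0] A := hfm.measurableSet_le hgm
  have mA0 : MeasurableSet A := hLE _ mA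
  have fi : Integrable f P := integrable_condExp
  have gi : Integrable g P := integrable_condExp
  have hmin : ∫ ω, min (f ω) (g ω) ∂P = (∫ ω in A, (ℓ (v ω) ω - ℓ (w ω) ω) ∂P) + ∫ ω, ℓ (w ω) ω ∂P := by
    have e1 : ∀ ω, min (f ω) (g ω) = A.indicator (fun ω => f ω - g ω) ω + g ω := by
      intro ω
      by_cases h : ω ∈ A
      · have h' : f ω ≤ g ω := h
        simp [h, h']
      · have h' : g ω ≤ f ω := le_of_lt (not_le.1 h)
        simp [h, h']
    simp only [e1]
    rw [integral_add ((isub fi gi).indicator mA0) gi, integral_indicator mA0,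
      integral_sub fi.restrict gi.restrict, hf, hg, setIntegral_condExp hLE iv mA, setIntegral_condExp hLE iw mA,
      integral_condExp hLE, integral_sub iv.restrict iw.restrict]
  refine le_of_forall_pos_le_add fun ε hε => ?_
  have hmono : Monotone fun n : ℕ => obsField T S Y (-(n : ℤ)) 0 := fun a b hab =>
    obsField_mono (by omega) le_rfl
  obtain ⟨n, A', hA', hle⟩ := approx_integral P (fun n : ℕ => obsField T S Y (-(n : ℤ)) 0) hmono
    (fun n => obsField_le hT hS hY _ _) (A := A) (by rw [← obsFieldLE_eq]; exact mA) hε (iv.sub iw)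
  simp only [Pi.sub_apply] at hle
  have mA'0 : MeasurableSet A' := obsField_le hT hS hY _ _ _ hA'
  classical
  obtain ⟨nv, hnv⟩ := (mem_Un_iff T S Y v).1 hv
  obtain ⟨nw, hnw⟩ := (mem_Un_iff T S Y w).1 hw
  have hz : A'.piecewise v w ∈ (Un T S Y 0 : Set (Ω → U)) := by
    refine (mem_Un_iff T S Y _).2 ⟨max n (max nv nw), ?_⟩
    refine Measurable.piecewise (m := obsField T S Y (-((max n (max nv nw) : ℕ) : ℤ)) 0) ?_ ?_ ?_
    · exact hmono (le_max_left _ _) _ hA'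
    · exact hnv.mono (hmono ((le_max_left nv nw).trans (le_max_right _ _))) le_rfl
    · exact hnw.mono (hmono ((le_max_right nv nw).trans (le_max_right _ _))) le_rfl
  have hcz := hc _ hz
  have e2 : ∀ ω, ℓ (A'.piecewise v w ω) ω = A'.indicator (fun ω => ℓ (v ω) ω - ℓ (w ω) ω) ω + ℓ (w ω) ω := by
    intro ω
    by_cases h : ω ∈ A' <;> simp [h]
  simp only [e2] at hcz
  rw [integral_add ((isub iv iw).indicator mA'0) iw, integral_indicator mA'0] at hcz
  linarith

lemma inf_le_gstar (hT : Measurable T) (hS : Measurable S)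
    (hℓ : Measurable fun p : U × Ω => ℓ p.1 p.2) (hΛ : Integrable Λ P)
    (hdom : ∀ u ω, |ℓ u ω| ≤ Λ ω) (hY : Y ≤ m0) (hne : Nonempty U)
    (gstar : Ω → ℝ) (hgi : Integrable gstar P)
    (hgstar : IsEssInfFam P (Un T S Y 0 : Set (Ω → U))
      (fun v => P[fun ω => ℓ (v ω) ω | obsFieldLE T S Y 0]) gstar)
    (ε : ℝ) (hε : 0 < ε) :
    ∃ v ∈ (Un T S Y 0 : Set (Ω → U)), ∫ ω, ℓ (v ω) ω ∂P ≤ (∫ ω, gstar ω ∂P) + ε := by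
  have hLE : obsFieldLE T S Y 0 ≤ m0 := obsFieldLE_le hT hS hY 0
  set c : ℝ := sInf ((fun v : Ω → U => ∫ ω, ℓ (v ω) ω ∂P) '' (Un T S Y 0 : Set (Ω → U))) with hcdef
  have hnon : ((fun v : Ω → U => ∫ ω, ℓ (v ω) ω ∂P) '' (Un T S Y 0 : Set (Ω → U))).Nonempty := by
    refine Set.Nonempty.image _ ⟨fun _ => hne.some, (mem_Un_iff T S Y _).2 ⟨0, measurable_const⟩⟩
  have hc : ∀ v ∈ (Un T S Y 0 : Set (Ω → U)), c ≤ ∫ ω, ℓ (v ω) ω ∂P := by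
    intro v hv
    refine csInf_le ⟨-∫ ω, Λ ω ∂P, ?_⟩ ⟨v, hv, rfl⟩
    rintro _ ⟨w, hw, rfl⟩
    simp only
    rw [← integral_neg]
    exact integral_mono hΛ.neg (loss_integrable hℓ hΛ hdom (Un_measurable hT hS hY hw))
      fun ω => (abs_le.1 (hdom _ _)).1
  suffices hcg : c ≤ ∫ ω, gstar ω ∂P by
    obtain ⟨_, ⟨v, hv, rfl⟩, hlt⟩ := exists_lt_of_csInf_lt hnon (show c < c + ε by linarith)
    exact ⟨v, hv, by simp only at hlt; linarith⟩
  have hseq : ∀ n : ℕ, ∃ v ∈ (Un T S Y 0 : Set (Ω → U)), ∫ ω, ℓ (v ω) ω ∂P < c + 1 / ((n : ℝ) + 1) := by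
    intro n
    obtain ⟨_, ⟨v, hv, rfl⟩, hlt⟩ := exists_lt_of_csInf_lt hnon
      (show c < c + 1 / ((n : ℝ) + 1) by have : 0 < 1 / ((n : ℝ) + 1) := by positivity
                                         linarith)
    exact ⟨v, hv, hlt⟩
  choose v hv hvlt using hseq
  set f : (Ω → U) → Ω → ℝ := fun v => P[fun ω => ℓ (v ω) ω | obsFieldLE T S Y 0] with hf
  have fi : ∀ v, Integrable (f v) P := fun v => integrable_condExp
  have fint : ∀ v, ∫ ω, f v ω ∂P = ∫ ω, ℓ (v ω) ω ∂P := fun v => integral_condExp hLE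
  have hglue : ∀ v ∈ (Un T S Y 0 : Set (Ω → U)), ∀ w ∈ (Un T S Y 0 : Set (Ω → U)),
      c ≤ ∫ ω, min (f v ω) (f w ω) ∂P := fun v hv w hw => glue hT hS hℓ hΛ hdom hY c hc hv hw
  have hdist : ∀ n m, ∫ ω, |f (v n) ω - f (v m) ω| ∂P ≤ 1 / ((n : ℝ) + 1) + 1 / ((m : ℝ) + 1) := by
    intro n m
    have e : ∀ ω, |f (v n) ω - f (v m) ω| = f (v n) ω + f (v m) ω - 2 * min (f (v n) ω) (f (v m) ω) := by
      intro ω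
      rcases le_total (f (v n) ω) (f (v m) ω) with h | h
      · rw [min_eq_left h, abs_of_nonpos (by linarith)]; ring
      · rw [min_eq_right h, abs_of_nonneg (by linarith)]; ring
    simp only [e]
    rw [integral_sub (iadd (fi _) (fi _)) ((imin (fi _) (fi _)).const_mul 2), integral_add (fi _) (fi _),
      integral_const_mul, fint, fint]
    have := hglue _ (hv n) _ (hv m)
    have := hvlt n; have := hvlt m
    linarith
  set x : ℕ → Lp ℝ 1 P := fun n => (fi (v n)).toL1 (f (v n)) with hx
  have hL1 : ∀ (a b : Ω → ℝ) (ha : Integrable a P) (hb : Integrable b P),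
      dist (ha.toL1 a) (hb.toL1 b) = ∫ ω, |a ω - b ω| ∂P := by
    intro a b ha hb
    rw [dist_eq_norm, ← Integrable.toL1_sub, L1.norm_of_fun_eq_integral_norm]
    rfl
  have hcau : CauchySeq x := by
    refine cauchySeq_of_le_tendsto_0 (fun n : ℕ => 2 * (1 / ((n : ℝ) + 1))) ?_ ?_
    · intro n m N hn hm
      have hn' : (N : ℝ) ≤ n := by exact_mod_cast hn
      have hm' : (N : ℝ) ≤ m := by exact_mod_cast hm
      rw [hL1]
      refine (hdist n m).trans ?_
      have h1 : 1 / ((n : ℝ) + 1) ≤ 1 / ((N : ℝ) + 1) := by gcongr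
      have h2 : 1 / ((m : ℝ) + 1) ≤ 1 / ((N : ℝ) + 1) := by gcongr
      linarith
    · simpa using tendsto_one_div_add_atTop_nhds_zero_nat (𝕜 := ℝ) |>.const_mul 2
  obtain ⟨z, hz⟩ := cauchySeq_tendsto_of_complete hcau
  have zi : Integrable z P := L1.integrable_coeFn z
  have hzlim : Tendsto (fun n => ∫ ω, |f (v n) ω - z ω| ∂P) atTop (𝓝 0) := by
    have h := tendsto_iff_dist_tendsto_zero.1 hz
    refine h.congr fun n => ?_
    conv_lhs => rw [← Integrable.toL1_coeFn z zi]
    exact hL1 _ _ _ _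
  have hzc : ∫ ω, z ω ∂P ≤ c := by
    have hlim : Tendsto (fun n : ℕ => c + 1 / ((n : ℝ) + 1) + ∫ ω, |f (v n) ω - z ω| ∂P) atTop (𝓝 (c + 0 + 0)) :=
      (tendsto_one_div_add_atTop_nhds_zero_nat.const_add c).add hzlim
    rw [add_zero, add_zero] at hlim
    refine ge_of_tendsto' hlim fun n => ?_
    have h1 : ∫ ω, z ω ∂P ≤ ∫ ω, (f (v n) ω + |f (v n) ω - z ω|) ∂P :=
      integral_mono zi ((fi _).add ((fi _).sub zi).abs) fun ω => by
        have := neg_abs_le (f (v n) ω - z ω); simp only; linarith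
    rw [integral_add (fi _) (isub (fi _) zi).abs, fint] at h1
    have := hvlt n
    linarith
  have hzle : ∀ w ∈ (Un T S Y 0 : Set (Ω → U)), ∀ᵐ ω ∂P, z ω ≤ f w ω := by
    intro w hw
    have hmi : Integrable (fun ω => min (z ω) (f w ω)) P := zi.inf (fi w)
    have h1 : c ≤ ∫ ω, min (z ω) (f w ω) ∂P := by
      have hlim : Tendsto (fun n : ℕ => (∫ ω, min (z ω) (f w ω) ∂P) + ∫ ω, |f (v n) ω - z ω| ∂P) atTop
          (𝓝 ((∫ ω, min (z ω) (f w ω) ∂P) + 0)) := hzlim.const_add _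
      rw [add_zero] at hlim
      refine ge_of_tendsto' hlim fun n => ?_
      refine (hglue _ (hv n) _ hw).trans ?_
      rw [← integral_add hmi (isub (fi _) zi).abs]
      refine integral_mono ((fi _).inf (fi _)) (hmi.add ((fi _).sub zi).abs) fun ω => ?_
      have := le_abs_self (f (v n) ω - z ω)
      have := abs_nonneg (f (v n) ω - z ω)
      have h3 := min_le_left (f (v n) ω) (f w ω)
      have h4 := min_le_right (f (v n) ω) (f w ω)
      simp only [Pi.inf_apply, Pi.add_apply]
      rcases min_choice (z ω) (f w ω) with h | h <;> rw [h] <;> linarith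
    have h2 : ∫ ω, (z ω - min (z ω) (f w ω)) ∂P = 0 := by
      refine le_antisymm ?_ (integral_nonneg fun ω => sub_nonneg.2 (min_le_left _ _))
      rw [integral_sub zi hmi]; linarith
    rw [integral_eq_zero_iff_of_nonneg (fun ω => sub_nonneg.2 (min_le_left _ _)) (zi.sub hmi)] at h2
    filter_upwards [h2] with ω h
    have h' : z ω - min (z ω) (f w ω) = 0 := h
    have := min_le_right (z ω) (f w ω)
    linarith
  have hzg : ∀ᵐ ω ∂P, z ω ≤ gstar ω :=
    hgstar.2.2 z (Lp.stronglyMeasurable z).measurable hzle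
  have hcz : c ≤ ∫ ω, z ω ∂P := by
    have hlim : Tendsto (fun n : ℕ => (∫ ω, z ω ∂P) + ∫ ω, |f (v n) ω - z ω| ∂P) atTop
          (𝓝 ((∫ ω, z ω ∂P) + 0)) := hzlim.const_add _
    rw [add_zero] at hlim
    refine ge_of_tendsto' hlim fun n => ?_
    refine (hc _ (hv n)).trans ?_
    rw [← fint, ← integral_add zi (isub (fi _) zi).abs]
    refine integral_mono (fi _) (zi.add ((fi _).sub zi).abs) fun ω => ?_
    have := le_abs_self (f (v n) ω - z ω)
    simp only [Pi.add_apply]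
    linarith
  exact hcz.trans (integral_mono_ae zi hgi hzg)

end Main


lemma sq_l1_le {Ω : Type*} [MeasurableSpace Ω] {P : Measure Ω} [IsProbabilityMeasure P] {h : Ω → ℝ}
    (hi : Integrable h P) (hi2 : Integrable (fun ω => h ω ^ 2) P) :
    (∫ ω, |h ω| ∂P) ^ 2 ≤ ∫ ω, h ω ^ 2 ∂P := by
  set a := ∫ ω, |h ω| ∂P with ha
  have h0 : 0 ≤ ∫ ω, (|h ω| - a) ^ 2 ∂P := integral_nonneg fun _ => sq_nonneg _
  have e : ∀ ω, (|h ω| - a) ^ 2 = h ω ^ 2 - (2 * a) * |h ω| + a ^ 2 := by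
    intro ω; rw [← sq_abs (h ω)]; ring
  simp only [e] at h0
  rw [integral_add (isub hi2 (hi.abs.const_mul _)) (integrable_const _),
    integral_sub hi2 (hi.abs.const_mul _), integral_const_mul, ← ha] at h0
  simp at h0
  nlinarith

lemma sum_dist_le (e : ℕ → ℝ) (he : ∀ k, 0 ≤ e k) (n j : ℕ) (hj : j ∈ Finset.Icc 1 n) :
    ∑ k ∈ Finset.Icc 1 n, e ((k - j) + (j - k)) ≤ 2 * (e 0 + ∑ d ∈ Finset.Icc 1 n, e d) := by
  have hr : e 0 + ∑ d ∈ Finset.Icc 1 n, e d = ∑ d ∈ Finset.range (n + 1), e d := by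
    rw [Finset.sum_range_succ', add_comm]
    congr 1
    have h1 : Finset.Icc 1 n = Finset.Ico (0 + 1) (n + 1) := by ext; simp
    rw [h1, ← Finset.sum_Ico_add', Finset.range_eq_Ico]
  rw [hr, two_mul, ← Finset.sum_filter_add_sum_filter_not (Finset.Icc 1 n) (fun k => k ≤ j)]
  have key : ∀ (s : Finset ℕ) (φ : ℕ → ℕ), Set.InjOn φ s → (∀ k ∈ s, φ k < n + 1) →
      ∑ k ∈ s, e (φ k) ≤ ∑ d ∈ Finset.range (n + 1), e d := by
    intro s φ hinj hlt
    rw [← Finset.sum_image (f := e) hinj]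
    refine Finset.sum_le_sum_of_subset_of_nonneg ?_ fun _ _ _ => he _
    intro x hx
    obtain ⟨k, hk, rfl⟩ := Finset.mem_image.1 hx
    exact Finset.mem_range.2 (hlt k hk)
  simp only [Finset.mem_Icc] at hj
  refine add_le_add (key _ _ ?_ ?_) (key _ _ ?_ ?_)
  · intro a ha b hb h
    simp at ha hb h; omega
  · intro a ha
    simp at ha; omega
  · intro a ha b hb h
    simp at ha hb h; omega
  · intro a ha
    simp at ha; omega

lemma second_moment {Ω : Type*} [MeasurableSpace Ω] {P : Measure Ω} (X : ℕ → Ω → ℝ) (e : ℕ → ℝ) (he : ∀ k, 0 ≤ e k)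
    (hX : ∀ j k, Integrable (fun ω => X j ω * X k ω) P)
    (hb : ∀ j k, j ≤ k → ∫ ω, X j ω * X k ω ∂P ≤ e (k - j)) (n : ℕ) :
    ∫ ω, ((n : ℝ)⁻¹ * ∑ k ∈ Finset.Icc 1 n, X k ω) ^ 2 ∂P ≤
      2 * ((n : ℝ)⁻¹ * e 0 + (n : ℝ)⁻¹ * ∑ d ∈ Finset.Icc 1 n, e d) := by
  rcases Nat.eq_zero_or_pos n with rfl | hn
  · simp
  have hn0 : (n : ℝ) ≠ 0 := by positivity
  have hb' : ∀ j k, ∫ ω, X j ω * X k ω ∂P ≤ e ((k - j) + (j - k)) := by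
    intro j k
    rcases le_total j k with h | h
    · have h1 := hb j k h
      rwa [Nat.sub_eq_zero_of_le h, add_zero]
    · have h1 := hb k j h
      rw [Nat.sub_eq_zero_of_le h, zero_add]
      simpa only [mul_comm] using h1
  have e1 : ∀ ω, ((n : ℝ)⁻¹ * ∑ k ∈ Finset.Icc 1 n, X k ω) ^ 2 =
      (n : ℝ)⁻¹ ^ 2 * ∑ j ∈ Finset.Icc 1 n, ∑ k ∈ Finset.Icc 1 n, X j ω * X k ω := by
    intro ω; rw [mul_pow, pow_two (∑ k ∈ Finset.Icc 1 n, X k ω), Finset.sum_mul_sum]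
  simp only [e1]
  rw [integral_const_mul, integral_finsetSum _ fun j _ => integrable_finsetSum _ fun k _ => hX j k]
  have e2 : ∀ j ∈ Finset.Icc 1 n, ∫ ω, ∑ k ∈ Finset.Icc 1 n, X j ω * X k ω ∂P ≤
      2 * (e 0 + ∑ d ∈ Finset.Icc 1 n, e d) := by
    intro j hj
    rw [integral_finsetSum _ fun k _ => hX j k]
    exact (Finset.sum_le_sum fun k _ => hb' j k).trans (sum_dist_le e he n j hj)
  have e3 := Finset.sum_le_card_nsmul _ _ _ e2
  rw [Nat.card_Icc, Nat.add_sub_cancel, nsmul_eq_mul] at e3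
  calc _ ≤ (n : ℝ)⁻¹ ^ 2 * (n * (2 * (e 0 + ∑ d ∈ Finset.Icc 1 n, e d))) := by gcongr
    _ = _ := by field_simp

lemma trunc_tendsto {Ω : Type*} [MeasurableSpace Ω] {P : Measure Ω} {Λ : Ω → ℝ} (hΛ : Integrable Λ P) :
    Tendsto (fun M : ℝ => ∫ ω, (if Λ ω ≤ M then 0 else |Λ ω|) ∂P) atTop (𝓝 0) := by
  have h := tendsto_integral_filter_of_dominated_convergence (μ := P) (l := (atTop : Filter ℝ))
    (F := fun M ω => if Λ ω ≤ M then 0 else |Λ ω|) (f := fun _ => (0 : ℝ)) (fun ω => |Λ ω|) ?_ ?_ hΛ.abs ?_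
  · simpa using h
  · refine Eventually.of_forall fun M => ?_
    have hn : NullMeasurableSet {ω | Λ ω ≤ M} P :=
      nullMeasurableSet_le hΛ.aemeasurable aemeasurable_const
    have : (fun ω => if Λ ω ≤ M then 0 else |Λ ω|) = {ω | Λ ω ≤ M}ᶜ.indicator (fun ω => |Λ ω|) := by
      ext ω; by_cases h : Λ ω ≤ M <;> simp [h]
    rw [this]
    exact hΛ.abs.1.indicator₀ hn.compl
  · refine Eventually.of_forall fun M => ae_of_all _ fun ω => ?_
    split_ifs <;> simp
  · refine ae_of_all _ fun ω => ?_
    refine tendsto_const_nhds.congr' ?_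
    filter_upwards [eventually_ge_atTop (Λ ω)] with M hM
    simp [hM]

section Noise

variable {Ω U : Type*} {Y : MeasurableSpace Ω} [m0 : MeasurableSpace Ω] [mU : MeasurableSpace U]
  {P : Measure Ω} [IsProbabilityMeasure P] {T S : Ω → Ω} {ℓ : U → Ω → ℝ} {Λ : Ω → ℝ}

lemma trunc_integrable (hℓ : Measurable fun p : U × Ω => ℓ p.1 p.2) (hΛ : Integrable Λ P)
    (hdom : ∀ u ω, |ℓ u ω| ≤ Λ ω) {v : Ω → U} (hv : Measurable v) (M : ℝ) :
    Integrable (truncLoss ℓ Λ M v) P := by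
  have hn : NullMeasurableSet {ω | Λ ω ≤ M} P :=
    nullMeasurableSet_le hΛ.aemeasurable aemeasurable_const
  have : truncLoss ℓ Λ M v = {ω | Λ ω ≤ M}.indicator (fun ω => ℓ (v ω) ω) := by
    ext ω; by_cases h : Λ ω ≤ M <;> simp [h, truncLoss]
  rw [this]
  exact (loss_integrable hℓ hΛ hdom hv).indicator₀ hn

lemma trunc_bound (hdom : ∀ u ω, |ℓ u ω| ≤ Λ ω) (v : Ω → U) {M : ℝ} (hM : 0 ≤ M) (ω : Ω) :
    |truncLoss ℓ Λ M v ω| ≤ M := by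
  unfold truncLoss
  split_ifs with h
  · exact (hdom _ _).trans h
  · simpa using hM

lemma bar_integrable (hℓ : Measurable fun p : U × Ω => ℓ p.1 p.2) (hΛ : Integrable Λ P)
    (hdom : ∀ u ω, |ℓ u ω| ≤ Λ ω) {v : Ω → U} (hv : Measurable v) (M : ℝ) :
    Integrable (barLoss P T S Y ℓ Λ M v) P :=
  (trunc_integrable hℓ hΛ hdom hv M).sub integrable_condExp

lemma bar_bound (hdom : ∀ u ω, |ℓ u ω| ≤ Λ ω) (v : Ω → U) {M : ℝ} (hM : 0 ≤ M) :
    ∀ᵐ ω ∂P, |barLoss P T S Y ℓ Λ M v ω| ≤ 2 * M := by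
  have h : ∀ᵐ ω ∂P, |(P[truncLoss ℓ Λ M v | obsFieldLE T S Y 0]) ω| ≤ (⟨M, hM⟩ : NNReal) :=
    ae_bdd_condExp_of_ae_bdd (R := ⟨M, hM⟩) (ae_of_all _ fun ω => trunc_bound hdom v hM ω)
  filter_upwards [h] with ω h1
  have h2 := trunc_bound hdom v hM ω
  unfold barLoss
  refine (abs_sub _ _).trans ?_
  have h1' : |(P[truncLoss ℓ Λ M v | obsFieldLE T S Y 0]) ω| ≤ M := h1
  linarith

/-- `T^j ∘ S^k = S^(k-j)`. -/
lemma TS_iter (hTS : Function.RightInverse S T) {j k : ℕ} (h : j ≤ k) (ω : Ω) :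
    T^[j] (S^[k] ω) = S^[k - j] ω := by
  have : S^[k] ω = S^[j] (S^[k - j] ω) := by
    rw [← Function.iterate_add_apply]; congr 2; omega
  rw [this]
  exact Function.LeftInverse.iterate hTS j _

lemma integral_comp_mp {R : Ω → Ω} (hR : MeasurePreserving R P P) {g : Ω → ℝ} (hg : AEStronglyMeasurable g P) :
    ∫ ω, g (R ω) ∂P = ∫ ω, g ω ∂P := by
  have := integral_map (μ := P) (φ := R) hR.measurable.aemeasurable (f := g) (by rw [hR.map_eq]; exact hg)
  rw [hR.map_eq] at this; exact this.symm

lemma noise_trunc (hT : MeasurePreserving T P P) (hS : MeasurePreserving S P P)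
    (hTS : Function.RightInverse S T)
    (hℓ : Measurable fun p : U × Ω => ℓ p.1 p.2) (hΛ : Integrable Λ P)
    (hdom : ∀ u ω, |ℓ u ω| ≤ Λ ω) (hY : Y ≤ m0) {M : ℝ} (hM : 0 ≤ M) (G : ℕ → Ω → ℝ)
    (hG : ∀ k : ℕ, IsEssSupFam P ((Un T S Y 0 : Set (Ω → U)) ×ˢ (Un T S Y 0 : Set (Ω → U)))
        (fun p ω =>
          |(P[(fun ω' => barLoss P T S Y ℓ Λ M p.1 (S^[k] ω') *
                barLoss P T S Y ℓ Λ M p.2 ω') | obsFieldLE T S Y 0]) ω|)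
        (G k))
    (v : ℕ → Ω → U) (hv : ∀ k, v k ∈ (Un T S Y 0 : Set (Ω → U))) :
    (∀ k, 0 ≤ ∫ ω, G k ω ∂P) ∧ (∀ k, ∫ ω, G k ω ∂P ≤ 2 * M * (2 * M)) ∧ (∀ k, Integrable (G k) P) ∧
    ∀ n : ℕ, (∫ ω, |(n : ℝ)⁻¹ * ∑ k ∈ Finset.Icc 1 n, barLoss P T S Y ℓ Λ M (v k) (T^[k] ω)| ∂P) ^ 2 ≤
      2 * ((n : ℝ)⁻¹ * (∫ ω, G 0 ω ∂P) + ∫ ω, (n : ℝ)⁻¹ * ∑ d ∈ Finset.Icc 1 n, G d ω ∂P) := by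
  have hTm := hT.measurable
  have hSm := hS.measurable
  have hLE : obsFieldLE T S Y 0 ≤ m0 := obsFieldLE_le hTm hSm hY 0
  set b : (Ω → U) → Ω → ℝ := barLoss P T S Y ℓ Λ M with hb
  have bi : ∀ w ∈ (Un T S Y 0 : Set (Ω → U)), Integrable (b w) P := fun w hw =>
    bar_integrable hℓ hΛ hdom (Un_measurable hTm hSm hY hw) M
  have bbd : ∀ w, ∀ᵐ ω ∂P, |b w ω| ≤ 2 * M := fun w => bar_bound hdom w hM
  have prod_bd : ∀ (R R' : Ω → Ω), MeasurePreserving R P P → MeasurePreserving R' P P →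
      ∀ w w' : Ω → U, ∀ᵐ ω ∂P, |b w (R ω) * b w' (R' ω)| ≤ 2 * M * (2 * M) := by
    intro R R' hR hR' w w'
    filter_upwards [hR.quasiMeasurePreserving.ae (bbd w), hR'.quasiMeasurePreserving.ae (bbd w')] with ω h1 h2
    rw [abs_mul]
    gcongr
  have prod_int : ∀ (R R' : Ω → Ω), MeasurePreserving R P P → MeasurePreserving R' P P →
      ∀ w ∈ (Un T S Y 0 : Set (Ω → U)), ∀ w' ∈ (Un T S Y 0 : Set (Ω → U)),
        Integrable (fun ω => b w (R ω) * b w' (R' ω)) P := by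
    intro R R' hR hR' w hw w' hw'
    refine Integrable.mono' (integrable_const (2 * M * (2 * M))) ?_ (prod_bd R R' hR hR' w w')
    exact ((hR.integrable_comp_of_integrable (bi w hw)).1).mul ((hR'.integrable_comp_of_integrable (bi w' hw')).1)
  have G_nonneg : ∀ k, ∀ᵐ ω ∂P, 0 ≤ G k ω := by
    intro k
    filter_upwards [(hG k).2.1 (v 0, v 0) ⟨hv 0, hv 0⟩] with ω h
    exact (abs_nonneg _).trans h
  have G_le : ∀ k, ∀ᵐ ω ∂P, G k ω ≤ 2 * M * (2 * M) := by
    intro k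
    refine (hG k).2.2 (fun _ => 2 * M * (2 * M)) measurable_const ?_
    rintro ⟨w, w'⟩ ⟨hw, hw'⟩
    exact ae_bdd_condExp_of_ae_bdd (R := ⟨2 * M * (2 * M), by positivity⟩)
      (prod_bd S^[k] _root_.id (hS.iterate k) (MeasurePreserving.id P) w w')
  have G_int : ∀ k, Integrable (G k) P := by
    intro k
    refine Integrable.mono' (integrable_const (2 * M * (2 * M))) (hG k).1.aestronglyMeasurable ?_
    filter_upwards [G_nonneg k, G_le k] with ω h1 h2
    rwa [Real.norm_eq_abs, abs_of_nonneg h1]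
  have e_nonneg : ∀ k, 0 ≤ ∫ ω, G k ω ∂P := fun k => integral_nonneg_of_ae (G_nonneg k)
  refine ⟨e_nonneg, fun k => ?_, G_int, fun n => ?_⟩
  · have := integral_mono_ae (G_int k) (integrable_const _) (G_le k)
    simpa using this
  set X : ℕ → Ω → ℝ := fun k ω => b (v k) (T^[k] ω) with hX
  have hXX : ∀ j k, Integrable (fun ω => X j ω * X k ω) P := fun j k =>
    prod_int _ _ (hT.iterate j) (hT.iterate k) _ (hv j) _ (hv k)
  have hXi : ∀ k, Integrable (X k) P := fun k => (hT.iterate k).integrable_comp_of_integrable (bi _ (hv k))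
  have hbd : ∀ j k, j ≤ k → ∫ ω, X j ω * X k ω ∂P ≤ ∫ ω, G (k - j) ω ∂P := by
    intro j k hjk
    rw [← integral_comp_mp (hS.iterate k) (hXX j k).1]
    have e : ∀ ω, X j (S^[k] ω) * X k (S^[k] ω) = b (v j) (S^[k - j] ω) * b (v k) ω := by
      intro ω
      simp only [hX, TS_iter hTS hjk, TS_iter hTS le_rfl, Nat.sub_self, Function.iterate_zero, _root_.id]
    simp only [e]
    rw [← integral_condExp hLE]
    refine integral_mono_ae integrable_condExp (G_int _) ?_
    filter_upwards [(hG (k - j)).2.1 (v j, v k) ⟨hv j, hv k⟩] with ω h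
    exact (le_abs_self _).trans h
  have h2 := second_moment X (fun k => ∫ ω, G k ω ∂P) e_nonneg hXX hbd n
  rw [integral_const_mul, integral_finsetSum _ fun k _ => G_int k]
  refine le_trans (sq_l1_le ((integrable_finsetSum _ fun k _ => hXi k).const_mul _) ?_) h2
  have e1 : ∀ ω, ((n : ℝ)⁻¹ * ∑ k ∈ Finset.Icc 1 n, X k ω) ^ 2 =
      (n : ℝ)⁻¹ ^ 2 * ∑ j ∈ Finset.Icc 1 n, ∑ k ∈ Finset.Icc 1 n, X j ω * X k ω := by
    intro ω; rw [mul_pow, pow_two (∑ k ∈ Finset.Icc 1 n, X k ω), Finset.sum_mul_sum]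
  refine Integrable.congr ?_ (ae_of_all _ fun ω => (e1 ω).symm)
  exact (integrable_finsetSum _ fun j _ => integrable_finsetSum _ fun k _ => hXX j k).const_mul _

lemma noise (hT : MeasurePreserving T P P) (hS : MeasurePreserving S P P)
    (hTS : Function.RightInverse S T)
    (hℓ : Measurable fun p : U × Ω => ℓ p.1 p.2) (hΛ : Integrable Λ P)
    (hdom : ∀ u ω, |ℓ u ω| ≤ Λ ω) (hY : Y ≤ m0) (hmix : UniformCondMixing P T S Y ℓ Λ)
    (v : ℕ → Ω → U) (hv : ∀ k, v k ∈ (Un T S Y 0 : Set (Ω → U))) :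
    Tendsto (fun n : ℕ => ∫ ω, |(n : ℝ)⁻¹ * ∑ k ∈ Finset.Icc 1 n,
      (ℓ (v k (T^[k] ω)) (T^[k] ω) - (P[fun ω => ℓ (v k ω) ω | obsFieldLE T S Y 0]) (T^[k] ω))| ∂P) atTop (𝓝 0) := by
  have hTm := hT.measurable
  have hSm := hS.measurable
  have hLE : obsFieldLE T S Y 0 ≤ m0 := obsFieldLE_le hTm hSm hY 0
  obtain ⟨G, hG, hlim⟩ := hmix
  rw [Metric.tendsto_atTop]
  intro ε hε
  have hδ : 0 < ε ^ 2 / 64 := by positivity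
  obtain ⟨M, hM0, hM1, hM2⟩ : ∃ M : ℝ, 0 ≤ M ∧ (∫ ω, (if Λ ω ≤ M then 0 else |Λ ω|) ∂P) < ε / 8 ∧
      Filter.limsup (fun n : ℕ => ∫ ω, (n : ℝ)⁻¹ * ∑ k ∈ Finset.Icc 1 n, G M k ω ∂P) atTop < ε ^ 2 / 64 := by
    have h1 := (trunc_tendsto hΛ).eventually_lt_const (show (0 : ℝ) < ε / 8 by positivity)
    have h2 := hlim.eventually_lt_const hδ
    exact ((eventually_ge_atTop (0 : ℝ)).and (h1.and h2)).exists
  obtain ⟨e0, e1, Gi, hn⟩ := noise_trunc hT hS hTS hℓ hΛ hdom hY hM0 (G M) (hG M) v hv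
  have hbdd : IsBoundedUnder (· ≤ ·) atTop (fun n : ℕ => ∫ ω, (n : ℝ)⁻¹ * ∑ k ∈ Finset.Icc 1 n, G M k ω ∂P) := by
    refine isBoundedUnder_of ⟨2 * M * (2 * M), fun n => ?_⟩
    rw [integral_const_mul, integral_finsetSum _ fun k _ => Gi k]
    have h3 := Finset.sum_le_card_nsmul (Finset.Icc 1 n) (fun k => ∫ ω, G M k ω ∂P) _ (fun k _ => e1 k)
    rw [Nat.card_Icc, Nat.add_sub_cancel, nsmul_eq_mul] at h3
    rcases Nat.eq_zero_or_pos n with rfl | hn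
    · simp; positivity
    · have hn0 : (n : ℝ) ≠ 0 := by positivity
      calc _ ≤ (n : ℝ)⁻¹ * (n * (2 * M * (2 * M))) := by gcongr
        _ = _ := by field_simp
  have hev := eventually_lt_of_limsup_lt hM2 hbdd
  have hev2 : ∀ᶠ n : ℕ in atTop, (n : ℝ)⁻¹ * (∫ ω, G M 0 ω ∂P) < ε ^ 2 / 64 := by
    have : Tendsto (fun n : ℕ => (n : ℝ)⁻¹ * (∫ ω, G M 0 ω ∂P)) atTop (𝓝 (0 * (∫ ω, G M 0 ω ∂P))) :=
      tendsto_inv_atTop_nhds_zero_nat.mul_const _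
    rw [zero_mul] at this
    exact this.eventually_lt_const hδ
  obtain ⟨N, hN⟩ := eventually_atTop.1 (hev.and hev2)
  refine ⟨N + 1, fun n hnN => ?_⟩
  obtain ⟨a1, a2⟩ := hN n (by omega)
  rw [Real.dist_eq, sub_zero, abs_of_nonneg (integral_nonneg fun _ => abs_nonneg _)]
  have hn0 : (n : ℝ) ≠ 0 := by have : 0 < n := by omega
                               positivity
  have hmain : ∫ ω, |(n : ℝ)⁻¹ * ∑ k ∈ Finset.Icc 1 n, barLoss P T S Y ℓ Λ M (v k) (T^[k] ω)| ∂P ≤ ε / 4 := by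
    refine le_of_sq_le_sq ?_ (by positivity)
    refine (hn n).trans ?_
    linarith [show (ε / 4) ^ 2 = 4 * (ε ^ 2 / 64) by ring]
  have lm : ∀ k, Integrable (fun ω => ℓ (v k ω) ω) P := fun k =>
    loss_integrable hℓ hΛ hdom (Un_measurable hTm hSm hY (hv k))
  have tm : ∀ k, Integrable (truncLoss ℓ Λ M (v k)) P := fun k =>
    trunc_integrable hℓ hΛ hdom (Un_measurable hTm hSm hY (hv k)) M
  set D : ℕ → Ω → ℝ := fun k ω => ℓ (v k ω) ω - (P[fun ω => ℓ (v k ω) ω | obsFieldLE T S Y 0]) ω -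
    barLoss P T S Y ℓ Λ M (v k) ω with hD
  have bi : ∀ k, Integrable (barLoss P T S Y ℓ Λ M (v k)) P := fun k =>
    bar_integrable hℓ hΛ hdom (Un_measurable hTm hSm hY (hv k)) M
  have Di : ∀ k, Integrable (D k) P := fun k => ((lm k).sub integrable_condExp).sub (bi k)
  have hDb : ∀ k, ∫ ω, |D k ω| ∂P ≤ ε / 4 := by
    intro k
    have di := isub (lm k) (tm k)
    have h1 : ∫ ω, |ℓ (v k ω) ω - truncLoss ℓ Λ M (v k) ω| ∂P ≤ ε / 8 := by
      refine le_trans (integral_mono_of_nonneg (ae_of_all _ fun _ => abs_nonneg _) ?_ (ae_of_all _ fun ω => ?_)) hM1.le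
      · have hnm : NullMeasurableSet {ω | Λ ω ≤ M} P :=
          nullMeasurableSet_le hΛ.aemeasurable aemeasurable_const
        have : (fun ω => if Λ ω ≤ M then 0 else |Λ ω|) = {ω | Λ ω ≤ M}ᶜ.indicator (fun ω => |Λ ω|) := by
          ext ω; by_cases h : Λ ω ≤ M <;> simp [h]
        rw [this]
        exact hΛ.abs.indicator₀ hnm.compl
      · simp only [truncLoss]
        split_ifs with h
        · simp
        · rw [sub_zero]; exact (hdom _ _).trans (le_abs_self _)
    have h2 := integral_abs_condExp_le (μ := P) (m := obsFieldLE T S Y 0) (fun ω => ℓ (v k ω) ω - truncLoss ℓ Λ M (v k) ω)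
    have h3 := l1_tri (P := P) (f := fun ω => ℓ (v k ω) ω - truncLoss ℓ Λ M (v k) ω)
      (g := P[fun ω => ℓ (v k ω) ω - truncLoss ℓ Λ M (v k) ω | obsFieldLE T S Y 0]) (h := D k) di integrable_condExp (by
        have h4 := condExp_sub (m := obsFieldLE T S Y 0) (lm k) (tm k)
        filter_upwards [h4] with ω h4
        have h5 : (P[fun ω => ℓ (v k ω) ω - truncLoss ℓ Λ M (v k) ω | obsFieldLE T S Y 0]) ω =
          (P[fun ω => ℓ (v k ω) ω | obsFieldLE T S Y 0]) ω - (P[truncLoss ℓ Λ M (v k) | obsFieldLE T S Y 0]) ω := h4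
        refine le_trans (le_of_eq ?_) (abs_sub _ _)
        rw [h5]
        simp only [hD, barLoss]
        ring_nf)
    linarith
  have hDa := abs_avg_le (P := P) (fun k ω => D k (T^[k] ω)) (fun k => (hT.iterate k).integrable_comp_of_integrable (Di k))
    (Finset.Icc 1 n) (n : ℝ)⁻¹ (ε / 4) (by positivity)
    (fun k => by rw [integral_comp_mp (hT.iterate k) (Di k).abs.1]; exact hDb k)
  rw [Nat.card_Icc, Nat.add_sub_cancel, inv_mul_cancel_left₀ hn0] at hDa
  have htri := l1_tri (P := P) (f := fun ω => (n : ℝ)⁻¹ * ∑ k ∈ Finset.Icc 1 n, D k (T^[k] ω))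
    (g := fun ω => (n : ℝ)⁻¹ * ∑ k ∈ Finset.Icc 1 n, barLoss P T S Y ℓ Λ M (v k) (T^[k] ω))
    (h := fun ω => (n : ℝ)⁻¹ * ∑ k ∈ Finset.Icc 1 n,
      (ℓ (v k (T^[k] ω)) (T^[k] ω) - (P[fun ω => ℓ (v k ω) ω | obsFieldLE T S Y 0]) (T^[k] ω)))
    ((integrable_finsetSum _ fun k _ => (hT.iterate k).integrable_comp_of_integrable (Di k)).const_mul _)
    ((integrable_finsetSum _ fun k _ => (hT.iterate k).integrable_comp_of_integrable (bi k)).const_mul _)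
    (ae_of_all _ fun ω => by
      refine le_trans (le_of_eq ?_) (abs_add_le _ _)
      rw [← mul_add, ← Finset.sum_add_distrib]
      simp only [hD, sub_add_cancel])
  linarith

end Noise


section Final

variable {Ω U : Type*} {Y : MeasurableSpace Ω} [m0 : MeasurableSpace Ω] [mU : MeasurableSpace U]
  {P : Measure Ω} [IsProbabilityMeasure P] {T S : Ω → Ω} {ℓ : U → Ω → ℝ} {Λ : Ω → ℝ}

/-- Decisions of a strategy, pulled back to time zero. -/
def pulled (S : Ω → Ω) (u : ℕ → Ω → U) (k : ℕ) : Ω → U := u (max k 1) ∘ S^[max k 1]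

lemma pulled_mem (hST : Function.LeftInverse S T) (hTS : Function.RightInverse S T)
    {u : ℕ → Ω → U} (hu : Admissible T S Y u) (k : ℕ) : pulled S u k ∈ (Un T S Y 0 : Set (Ω → U)) := by
  refine (mem_Un_iff T S Y _).2 ⟨max k 1, ?_⟩
  have h := shift_measurable T S hST hTS Y 0 ((max k 1 : ℕ) : ℤ) (-((max k 1 : ℕ) : ℤ)) (u (max k 1))
    (hu _ (le_max_right _ _))
  rw [iter_neg, zero_add, add_neg_cancel] at h
  exact h

lemma pulled_apply (hST : Function.LeftInverse S T) (u : ℕ → Ω → U) {k : ℕ} (hk : 1 ≤ k) (ω : Ω) :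
    pulled S u k (T^[k] ω) = u k ω := by
  simp only [pulled, max_eq_left hk, Function.comp]
  rw [(hST.iterate k) ω]

lemma lossAt_integrable (hT : MeasurePreserving T P P) (hℓ : Measurable fun p : U × Ω => ℓ p.1 p.2)
    (hΛ : Integrable Λ P) (hdom : ∀ u ω, |ℓ u ω| ≤ Λ ω) (k : ℕ) {w : Ω → U} (hw : Measurable w) :
    Integrable (lossAt T S ℓ (k : ℤ) w) P := by
  refine ((hT.iterate k).integrable_comp_of_integrable hΛ).mono' ?_ (ae_of_all _ fun ω => hdom _ _)
  exact (hℓ.comp (hw.prodMk (hT.iterate k).measurable)).aestronglyMeasurable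

lemma gstar_integrable (hT : Measurable T) (hS : Measurable S)
    (hℓ : Measurable fun p : U × Ω => ℓ p.1 p.2) (hΛ : Integrable Λ P)
    (hdom : ∀ u ω, |ℓ u ω| ≤ Λ ω) (hY : Y ≤ m0) (hne : Nonempty U) (gstar : Ω → ℝ)
    (hgstar : IsEssInfFam P (Un T S Y 0 : Set (Ω → U))
      (fun v => P[fun ω => ℓ (v ω) ω | obsFieldLE T S Y 0]) gstar) : Integrable gstar P := by
  have hLE : obsFieldLE T S Y 0 ≤ m0 := obsFieldLE_le hT hS hY 0
  obtain ⟨x⟩ := hne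
  have hx : (fun _ => x) ∈ (Un T S Y 0 : Set (Ω → U)) :=
    (mem_Un_iff T S Y _).2 ⟨0, @measurable_const _ _ _ (obsField T S Y _ 0) x⟩
  have h1 := hgstar.2.1 _ hx
  have h2 := hgstar.2.2 (fun ω => -(P[Λ | obsFieldLE T S Y 0]) ω)
    ((stronglyMeasurable_condExp.mono hLE).measurable.neg) (by
      intro v hv
      have hi := loss_integrable (P := P) hℓ hΛ hdom (Un_measurable hT hS hY hv)
      have ha := condExp_mono (m := obsFieldLE T S Y 0) hΛ.neg hi
        (ae_of_all _ fun ω => (abs_le.1 (hdom (v ω) ω)).1)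
      filter_upwards [ha, condExp_neg (μ := P) Λ (obsFieldLE T S Y 0)] with ω ha hb
      rw [hb] at ha
      exact ha)
  have i1 : Integrable (P[Λ | obsFieldLE T S Y 0]) P := integrable_condExp
  have i2 : Integrable (P[fun ω => ℓ x ω | obsFieldLE T S Y 0]) P := integrable_condExp
  refine (i1.abs.add i2.abs).mono' hgstar.1.aestronglyMeasurable ?_
  filter_upwards [h1, h2] with ω h1 h2
  simp only [Pi.add_apply, Real.norm_eq_abs]
  refine abs_le.2 ⟨?_, ?_⟩
  · have := le_abs_self ((P[Λ | obsFieldLE T S Y 0]) ω)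
    have := abs_nonneg ((P[fun ω => ℓ x ω | obsFieldLE T S Y 0]) ω)
    linarith
  · have := abs_nonneg ((P[Λ | obsFieldLE T S Y 0]) ω)
    have := le_abs_self ((P[fun ω => ℓ x ω | obsFieldLE T S Y 0]) ω)
    linarith

lemma mean_loss_le (hT : MeasurePreserving T P P) (hS : MeasurePreserving S P P)
    (hST : Function.LeftInverse S T) (hTS : Function.RightInverse S T)
    (hℓ : Measurable fun p : U × Ω => ℓ p.1 p.2) (hΛ : Integrable Λ P)
    (hdom : ∀ u ω, |ℓ u ω| ≤ Λ ω) (hY : Y ≤ m0) (ut : ℕ → Ω → U)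
    (hut : MeanOptimalStrategy P T S Y ℓ ut)
    {v : Ω → U} (hv : v ∈ (Un T S Y 0 : Set (Ω → U))) :
    ∃ m : ℕ, ∀ k : ℕ, m ≤ k → 1 ≤ k →
      ∫ ω, lossAt T S ℓ (k : ℤ) (ut k) ω ∂P ≤ (∫ ω, ℓ (v ω) ω ∂P) + (k : ℝ)⁻¹ := by
  obtain ⟨m, hm⟩ := (mem_Un_iff T S Y v).1 hv
  refine ⟨m, fun k hmk hk => ?_⟩
  have hle := obsField_le hT.measurable hS.measurable hY 0 (k : ℤ)
  obtain ⟨g, hg, hgk⟩ := hut.2 k hk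
  have hw : Measurable[obsField T S Y 0 (k : ℤ)] (v ∘ T^[k]) := by
    have h := shift_measurable T S hST hTS Y (-(m : ℤ)) 0 (k : ℤ) v hm
    exact h.mono (obsField_mono (by omega) (by omega)) le_rfl
  have hgw := hg.2.1 (v ∘ T^[k]) hw
  have h1 : ∫ ω, (P[lossAt T S ℓ (k : ℤ) (ut k) | obsField T S Y 0 (k : ℤ)]) ω ∂P ≤
      ∫ ω, ((P[lossAt T S ℓ (k : ℤ) (v ∘ T^[k]) | obsField T S Y 0 (k : ℤ)]) ω + (k : ℝ)⁻¹) ∂P := by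
    refine integral_mono_ae integrable_condExp (iadd integrable_condExp (integrable_const _)) ?_
    filter_upwards [hgk, hgw] with ω h1 h2
    linarith
  rw [integral_add integrable_condExp (integrable_const _), integral_condExp hle, integral_condExp hle] at h1
  have hvi := loss_integrable (P := P) hℓ hΛ hdom (Un_measurable hT.measurable hS.measurable hY hv)
  have h2 : ∫ ω, lossAt T S ℓ (k : ℤ) (v ∘ T^[k]) ω ∂P = ∫ ω, ℓ (v ω) ω ∂P :=
    integral_comp_mp (hT.iterate k) hvi.1
  rw [h2] at h1
  simpa using h1

lemma cesaro_Icc {d : ℕ → ℝ} (hd : Tendsto d atTop (𝓝 0)) :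
    Tendsto (fun n : ℕ => (n : ℝ)⁻¹ * ∑ k ∈ Finset.Icc 1 n, d k) atTop (𝓝 0) := by
  have h := (hd.comp (tendsto_add_atTop_nat 1)).cesaro
  refine h.congr fun n => ?_
  congr 1
  have h1 : Finset.Icc 1 n = Finset.Ico (0 + 1) (n + 1) := by ext; simp
  rw [h1, ← Finset.sum_Ico_add', Finset.range_eq_Ico]
  rfl

theorem main_thm (hE : Ergodic T P) (hS : MeasurePreserving S P P)
    (hST : Function.LeftInverse S T) (hTS : Function.RightInverse S T)
    (hℓ : Measurable fun p : U × Ω => ℓ p.1 p.2) (hΛ : Integrable Λ P)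
    (hdom : ∀ u ω, |ℓ u ω| ≤ Λ ω) (hY : Y ≤ m0)
    (hmix : UniformCondMixing P T S Y ℓ Λ) (gstar : Ω → ℝ)
    (hgstar : IsEssInfFam P (Un T S Y 0 : Set (Ω → U))
      (fun v => P[fun ω => ℓ (v ω) ω | obsFieldLE T S Y 0]) gstar)
    (ut : ℕ → Ω → U) (hut : MeanOptimalStrategy P T S Y ℓ ut) :
    WeaklyPathwiseOptimal P T S Y ℓ ut ∧
      Tendsto (fun n : ℕ => ∫ ω, |avgLoss T S ℓ ut n ω - ∫ ω', gstar ω' ∂P| ∂P)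
        atTop (𝓝 0) := by
  have hT : MeasurePreserving T P P := hE.toMeasurePreserving
  have hLE : obsFieldLE T S Y 0 ≤ m0 := obsFieldLE_le hT.measurable hS.measurable hY 0
  have hne : Nonempty U := by
    obtain ⟨ω⟩ := nonempty_of_isProbabilityMeasure P
    exact ⟨ut 0 ω⟩
  have hgi := gstar_integrable hT.measurable hS.measurable hℓ hΛ hdom hY hne gstar hgstar
  have hgk : ∀ k : ℕ, Integrable (fun ω => gstar (T^[k] ω)) P := fun k =>
    (hT.iterate k).integrable_comp_of_integrable hgi
  have umeas : ∀ u : ℕ → Ω → U, Admissible T S Y u → ∀ k, 1 ≤ k → Measurable (u k) := fun u hu k hk =>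
    (hu k hk).mono (obsField_le hT.measurable hS.measurable hY _ _) le_rfl
  have lint : ∀ u : ℕ → Ω → U, Admissible T S Y u → ∀ k : ℕ, 1 ≤ k →
      Integrable (lossAt T S ℓ (k : ℤ) (u k)) P := fun u hu k hk =>
    lossAt_integrable hT hℓ hΛ hdom k (umeas u hu k hk)
  have aint : ∀ u : ℕ → Ω → U, Admissible T S Y u → ∀ n, Integrable (avgLoss T S ℓ u n) P := fun u hu n =>
    (integrable_finsetSum _ fun k hk => lint u hu k (Finset.mem_Icc.1 hk).1).const_mul _
  set F : (ℕ → Ω → U) → ℕ → Ω → ℝ := fun u k => P[fun ω => ℓ (pulled S u k ω) ω | obsFieldLE T S Y 0] with hF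
  have Fi : ∀ u k, Integrable (F u k) P := fun u k => integrable_condExp
  have FiT : ∀ u (k : ℕ), Integrable (fun ω => F u k (T^[k] ω)) P := fun u k =>
    (hT.iterate k).integrable_comp_of_integrable (Fi u k)
  set N : (ℕ → Ω → U) → ℕ → Ω → ℝ := fun u n ω =>
    (n : ℝ)⁻¹ * ∑ k ∈ Finset.Icc 1 n, (lossAt T S ℓ (k : ℤ) (u k) ω - F u k (T^[k] ω)) with hN
  have Ni : ∀ u, Admissible T S Y u → ∀ n, Integrable (N u n) P := fun u hu n =>
    (integrable_finsetSum _ fun k hk =>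
      isub (lint u hu k (Finset.mem_Icc.1 hk).1) (FiT u k)).const_mul _
  have Nlim : ∀ u, Admissible T S Y u → Tendsto (fun n => ∫ ω, |N u n ω| ∂P) atTop (𝓝 0) := by
    intro u hu
    refine (noise hT hS hTS hℓ hΛ hdom hY hmix (pulled S u) (pulled_mem hST hTS hu)).congr fun n => ?_
    refine integral_congr_ae (ae_of_all _ fun ω => ?_)
    simp only [hN]
    congr 2
    refine Finset.sum_congr rfl fun k hk => ?_
    rw [pulled_apply hST u (Finset.mem_Icc.1 hk).1 ω]
    rfl
  set A : ℕ → Ω → ℝ := fun n ω => (n : ℝ)⁻¹ * ∑ k ∈ Finset.Icc 1 n, gstar (T^[k] ω) with hA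
  have Ai : ∀ n, Integrable (A n) P := fun n => (integrable_finsetSum _ fun k _ => hgk k).const_mul _
  have Fge : ∀ u, Admissible T S Y u → ∀ᵐ ω ∂P, ∀ k : ℕ, gstar (T^[k] ω) ≤ F u k (T^[k] ω) := by
    intro u hu
    rw [ae_all_iff]
    intro k
    exact (hT.iterate k).quasiMeasurePreserving.ae (hgstar.2.1 _ (pulled_mem hST hTS hu k))
  -- decomposition
  have dec : ∀ u n ω, avgLoss T S ℓ u n ω = N u n ω + (n : ℝ)⁻¹ * ∑ k ∈ Finset.Icc 1 n, F u k (T^[k] ω) := by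
    intro u n ω
    simp only [hN, avgLoss]
    rw [← mul_add, ← Finset.sum_add_distrib]
    simp only [sub_add_cancel]
  have Age : ∀ u, Admissible T S Y u → ∀ᵐ ω ∂P, ∀ n, N u n ω + A n ω ≤ avgLoss T S ℓ u n ω := by
    intro u hu
    filter_upwards [Fge u hu] with ω h n
    rw [dec]
    have : A n ω ≤ (n : ℝ)⁻¹ * ∑ k ∈ Finset.Icc 1 n, F u k (T^[k] ω) :=
      mul_le_mul_of_nonneg_left (Finset.sum_le_sum fun k _ => h k) (by positivity)
    linarith
  have hua := hut.1
  -- excess mean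
  set d : ℕ → ℝ := fun k => (∫ ω, F ut k ω ∂P) - ∫ ω, gstar ω ∂P with hd
  have Fint : ∀ k, 1 ≤ k → ∫ ω, F ut k ω ∂P = ∫ ω, lossAt T S ℓ (k : ℤ) (ut k) ω ∂P := by
    intro k hk
    have hvi := loss_integrable (P := P) hℓ hΛ hdom
      (Un_measurable hT.measurable hS.measurable hY (pulled_mem hST hTS hua k))
    simp only [hF]
    rw [integral_condExp hLE, ← integral_comp_mp (hT.iterate k) hvi.1]
    refine integral_congr_ae (ae_of_all _ fun ω => ?_)
    simp only [pulled_apply hST ut hk ω]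
    rfl
  have d0 : ∀ k, 0 ≤ d k := by
    intro k
    have := integral_mono_ae hgi (Fi ut k) (hgstar.2.1 _ (pulled_mem hST hTS hua k))
    simp only [hd]
    linarith
  have dlim : Tendsto d atTop (𝓝 0) := by
    rw [Metric.tendsto_atTop]
    intro ε hε
    obtain ⟨v, hv, hvl⟩ := inf_le_gstar hT.measurable hS.measurable hℓ hΛ hdom hY hne gstar hgi hgstar
      (ε / 3) (by positivity)
    obtain ⟨m, hm⟩ := mean_loss_le hT hS hST hTS hℓ hΛ hdom hY ut hut hv
    obtain ⟨q, hq⟩ := exists_nat_gt (3 / ε)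
    refine ⟨max m (max 1 q), fun k hk => ?_⟩
    have hk1 : m ≤ k := (le_max_left _ _).trans hk
    have hk2 : 1 ≤ k := (le_max_left _ _).trans ((le_max_right _ _).trans hk)
    have hk3 : q ≤ k := (le_max_right _ _).trans ((le_max_right _ _).trans hk)
    have h1 := hm k hk1 hk2
    rw [← Fint k hk2] at h1
    have hk4 : 3 / ε < (k : ℝ) := hq.trans_le (by exact_mod_cast hk3)
    have h2 : (k : ℝ)⁻¹ < ε / 3 := by
      rw [inv_lt_comm₀ (by positivity) (by positivity), inv_div]
      exact hk4
    rw [Real.dist_eq, sub_zero, abs_of_nonneg (d0 k)]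
    simp only [hd]
    linarith
  -- distance to the ergodic averages
  have step : Tendsto (fun n => ∫ ω, |avgLoss T S ℓ ut n ω - A n ω| ∂P) atTop (𝓝 0) := by
    have hlim := (Nlim ut hua).add (cesaro_Icc dlim)
    rw [add_zero] at hlim
    refine squeeze_zero (fun n => integral_nonneg fun _ => abs_nonneg _) (fun n => ?_) hlim
    have hB : Integrable (fun ω => (n : ℝ)⁻¹ * ∑ k ∈ Finset.Icc 1 n, (F ut k (T^[k] ω) - gstar (T^[k] ω))) P :=
      (integrable_finsetSum _ fun k _ => isub (FiT ut k) (hgk k)).const_mul _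
    have e : ∀ ω, avgLoss T S ℓ ut n ω - A n ω =
        N ut n ω + (n : ℝ)⁻¹ * ∑ k ∈ Finset.Icc 1 n, (F ut k (T^[k] ω) - gstar (T^[k] ω)) := by
      intro ω
      rw [dec, Finset.sum_sub_distrib, mul_sub]
      simp only [hA]
      ring
    have h1 := l1_tri (Ni ut hua n) hB (ae_of_all _ fun ω => (by rw [e]; exact abs_add_le _ _ :
      |avgLoss T S ℓ ut n ω - A n ω| ≤ _))
    refine h1.trans (add_le_add le_rfl (le_of_eq ?_))
    have e2 : ∫ ω, |(n : ℝ)⁻¹ * ∑ k ∈ Finset.Icc 1 n, (F ut k (T^[k] ω) - gstar (T^[k] ω))| ∂P =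
        ∫ ω, (n : ℝ)⁻¹ * ∑ k ∈ Finset.Icc 1 n, (F ut k (T^[k] ω) - gstar (T^[k] ω)) ∂P := by
      refine integral_congr_ae ?_
      filter_upwards [Fge ut hua] with ω h
      exact abs_of_nonneg (mul_nonneg (by positivity) (Finset.sum_nonneg fun k _ => sub_nonneg.2 (h k)))
    rw [e2, integral_const_mul, integral_finsetSum _ fun k _ => isub (FiT ut k) (hgk k)]
    congr 1
    refine Finset.sum_congr rfl fun k _ => ?_
    rw [integral_sub (FiT ut k) (hgk k), integral_comp_mp (hT.iterate k) (Fi ut k).1,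
      integral_comp_mp (hT.iterate k) hgi.1]
  refine ⟨⟨hua, fun u hu ε hε => ?_⟩, ?_⟩
  · have hlim := (Nlim u hu).add step
    rw [add_zero] at hlim
    have hlim2 : Tendsto (fun n => ENNReal.ofReal (((∫ ω, |N u n ω| ∂P) +
        ∫ ω, |avgLoss T S ℓ ut n ω - A n ω| ∂P) / ε)) atTop (𝓝 0) := by
      have := ENNReal.tendsto_ofReal (hlim.div_const ε)
      simpa using this
    have hbd : ∀ n, 1 - ENNReal.ofReal (((∫ ω, |N u n ω| ∂P) +
        ∫ ω, |avgLoss T S ℓ ut n ω - A n ω| ∂P) / ε) ≤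
        P {ω | -ε ≤ avgLoss T S ℓ u n ω - avgLoss T S ℓ ut n ω} := by
      intro n
      have hBi : Integrable (fun ω => |N u n ω| + |avgLoss T S ℓ ut n ω - A n ω|) P :=
        iadd (Ni u hu n).abs (isub (aint ut hua n) (Ai n)).abs
      have hmk := mul_meas_ge_le_integral_of_nonneg (ae_of_all P fun ω =>
        add_nonneg (abs_nonneg (N u n ω)) (abs_nonneg (avgLoss T S ℓ ut n ω - A n ω))) hBi ε
      rw [integral_add (Ni u hu n).abs (isub (aint ut hua n) (Ai n)).abs] at hmk
      set Bad : Set Ω := {ω | ε ≤ |N u n ω| + |avgLoss T S ℓ ut n ω - A n ω|} with hBad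
      have hb1 : P Bad ≤ ENNReal.ofReal (((∫ ω, |N u n ω| ∂P) +
          ∫ ω, |avgLoss T S ℓ ut n ω - A n ω| ∂P) / ε) := by
        rw [ENNReal.le_ofReal_iff_toReal_le (measure_ne_top _ _) (by positivity), le_div_iff₀ hε, mul_comm]
        exact hmk
      set Good : Set Ω := {ω | -ε ≤ avgLoss T S ℓ u n ω - avgLoss T S ℓ ut n ω} with hGood
      have hcov : ∀ᵐ ω ∂P, ω ∈ Good ∪ Bad := by
        filter_upwards [Age u hu] with ω h
        by_cases hb : ω ∈ Bad
        · exact Or.inr hb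
        · left
          have hb' : |N u n ω| + |avgLoss T S ℓ ut n ω - A n ω| < ε := not_le.1 hb
          have h1 := neg_abs_le (N u n ω)
          have h2 := le_abs_self (avgLoss T S ℓ ut n ω - A n ω)
          have h3 := h n
          show -ε ≤ avgLoss T S ℓ u n ω - avgLoss T S ℓ ut n ω
          linarith
      have h4 := (measure_congr (eventuallyEq_univ.2 hcov)).symm.le.trans (measure_union_le (μ := P) Good Bad)
      rw [measure_univ] at h4
      rw [tsub_le_iff_right]
      exact h4.trans (add_le_add le_rfl hb1)
    refine tendsto_of_tendsto_of_tendsto_of_le_of_le ?_ tendsto_const_nhds hbd (fun n => prob_le_one)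
    have := ENNReal.Tendsto.sub (tendsto_const_nhds (x := (1 : ℝ≥0∞))) hlim2 (Or.inl ENNReal.one_ne_top)
    simpa using this
  · have hlim := step.add (mean_ergodic_L1 hE hgi)
    rw [add_zero] at hlim
    refine squeeze_zero (fun n => integral_nonneg fun _ => abs_nonneg _) (fun n => ?_) hlim
    refine l1_tri (f := fun ω => avgLoss T S ℓ ut n ω - A n ω) (g := fun ω => A n ω - ∫ ω, gstar ω ∂P)
      (isub (aint ut hua n) (Ai n)) (isub (Ai n) (integrable_const _)) (ae_of_all _ fun ω => ?_)
    refine le_trans (le_of_eq ?_) (abs_add_le _ _)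
    congr 1
    ring

end Final


/-- Theorem 2.12: under the uniform conditional mixing assumption, every
mean-optimal strategy `ũ` is weakly pathwise optimal and `L_T(ũ) → L⋆` in `L¹(P)`. -/
theorem statement6
    {Ω U : Type*} [m0 : MeasurableSpace Ω] [MeasurableSpace U]
    (P : Measure Ω) [IsProbabilityMeasure P]
    (T S : Ω → Ω) (hT : Ergodic T P) (hS : MeasurePreserving S P P)
    (hST : Function.LeftInverse S T) (hTS : Function.RightInverse S T)
    (ℓ : U → Ω → ℝ) (hℓ : Measurable fun p : U × Ω => ℓ p.1 p.2)
    (Λ : Ω → ℝ) (hΛ : Integrable Λ P) (hdom : ∀ u ω, |ℓ u ω| ≤ Λ ω)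
    (Y : MeasurableSpace Ω) (hY : Y ≤ m0)
    (hmix : UniformCondMixing P T S Y ℓ Λ)
    (gstar : Ω → ℝ)
    (hgstar : IsEssInfFam P (Un T S Y 0 : Set (Ω → U))
      (fun v => P[lossAt T S ℓ 0 v | obsFieldLE T S Y 0]) gstar)
    (ut : ℕ → Ω → U) (hut : MeanOptimalStrategy P T S Y ℓ ut) :
    WeaklyPathwiseOptimal P T S Y ℓ ut ∧
      Tendsto (fun n : ℕ => ∫ ω, |avgLoss T S ℓ ut n ω - ∫ ω', gstar ω' ∂P| ∂P)
        atTop (𝓝 0) := by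
  exact @main_thm Ω U Y m0 _ P _ T S ℓ Λ hT hS hST hTS hℓ hΛ hdom hY hmix gstar hgstar ut hut

end ErgodicDecisions
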